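/- arXiv:math/0205039 — 2 statements merged into one kernel-verified Lean document; each statement's English description precedes it below -/
import Mathlib

section
/- Let A ⊂ ℝ^{2n} be a bounded open set and let φ be a C² symplectomorphism of ℝ^{2n} equal to the identity outside a compact subset of A. Suppose that for every ε > 0 there exists a C² Hamiltonian K : [0, 1] × ℝ^{2n} → ℝ with compact support contained in A, whose Hamiltonian flow has time-one map equal to φ, and with ∫₀¹ sup_x |K(t, x)| dt < ε. Then φ is the identity map of ℝ^{2n}. (Non-degeneracy of the Hofer distance.) -/
open MeasureTheory Set Function
open scoped BigOperators Topology NNReal ENNReal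

noncomputable section

/-- `ℝ^{2n}` with the Euclidean norm. -/
abbrev E (n : ℕ) := EuclideanSpace ℝ (Fin n ⊕ Fin n)

/-- The standard symplectic form `ω(x,y) = ⟨Jx, y⟩` on `ℝ^{2n}`. -/
def symp {n : ℕ} (x y : E n) : ℝ :=
  ∑ i : Fin n, (x (Sum.inl i) * y (Sum.inr i) - x (Sum.inr i) * y (Sum.inl i))

/-- `K` is an admissible Hamiltonian for `φ` in `A`: it is `C²`, compactly supported
in `A`, and its Hamiltonian flow on `[0,1]` has time-one map `φ`. -/
def AdmissibleHamiltonian {n : ℕ} (A : Set (E n)) (φ : E n → E n)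
    (K : ℝ → E n → ℝ) : Prop :=
  ContDiff ℝ 2 (Function.uncurry K) ∧
  (∃ C : Set (E n), IsCompact C ∧ C ⊆ A ∧ ∀ (t : ℝ) (x : E n), x ∉ C → K t x = 0) ∧
  ∃ ψ : ℝ → E n → E n, ψ 0 = id ∧
    (∀ x : E n, ∀ t ∈ Icc (0:ℝ) 1,
      ∃ v' : E n, HasDerivAt (fun s : ℝ => ψ s x) v' t ∧
        ∀ v : E n, symp v' v = -(fderiv ℝ (K t) (ψ t x) v)) ∧
    ψ 1 = φ

section Brouwer

variable {W : Type*} [NormedAddCommGroup W] [InnerProductSpace ℝ W] [FiniteDimensional ℝ W]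

/-- `det (1 + A)` is a fixed affine combination of the values `det (1 + t • A)` at small `t`. -/
theorem exists_det_one_add_interpolation {δ : ℝ} (hδ : 0 < δ) :
    ∃ (s : Finset ℕ) (c t : ℕ → ℝ), (∀ i ∈ s, 0 < t i ∧ t i < δ) ∧ ∑ i ∈ s, c i = 1 ∧
      ∀ A : W →L[ℝ] W, (1 + A).det = ∑ i ∈ s, c i * (1 + t i • A).det := by
  classical
  let d := Module.finrank ℝ W
  let b := Module.finBasis ℝ W
  let t : ℕ → ℝ := fun i => δ / (i + 2)
  have ht : Set.InjOn t (Finset.range (d + 1)) := by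
    intro i _ j _ hij
    have hi : (0 : ℝ) < i + 2 := by positivity
    have hj : (0 : ℝ) < j + 2 := by positivity
    simp only [t] at hij
    rw [div_eq_div_iff hi.ne' hj.ne'] at hij
    have := mul_left_cancel₀ hδ.ne' hij
    exact_mod_cast (by linarith : (i : ℝ) = j)
  refine ⟨Finset.range (d + 1),
    fun i => (Lagrange.basis (Finset.range (d + 1)) t i).eval 1, t, ?_, ?_, ?_⟩
  · intro i _
    refine ⟨by positivity, ?_⟩
    rw [div_lt_iff₀ (by positivity)]
    nlinarith [(Nat.cast_nonneg i : (0 : ℝ) ≤ i)]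
  · rw [← Polynomial.eval_finsetSum, Lagrange.sum_basis ht ⟨0, by simp⟩, Polynomial.eval_one]
  · intro A
    let M := LinearMap.toMatrix b b (A : W →ₗ[ℝ] W)
    let P : Polynomial ℝ := Matrix.det
      ((Polynomial.X : Polynomial ℝ) • M.map Polynomial.C +
        (1 : Matrix (Fin d) (Fin d) ℝ).map Polynomial.C)
    have hP : ∀ s : ℝ, P.eval s = (1 + s • A).det := by
      intro s
      have h1 : (1 + s • A).det = Matrix.det (1 + s • M) := by
        rw [ContinuousLinearMap.det, ← LinearMap.det_toMatrix b]
        congr 1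
        have : ((1 + s • A : W →L[ℝ] W) : W →ₗ[ℝ] W) = LinearMap.id + s • (A : W →ₗ[ℝ] W) := rfl
        rw [this, map_add, map_smul, LinearMap.toMatrix_id]
      rw [h1, ← Polynomial.coe_evalRingHom, RingHom.map_det]
      congr 1
      ext i j
      simp [Matrix.one_apply, Matrix.map_apply]
      split_ifs <;> simp <;> ring
    have hdeg : P.degree < (Finset.range (d + 1)).card := by
      refine lt_of_le_of_lt (Polynomial.degree_le_natDegree) ?_
      have := Polynomial.natDegree_det_X_add_C_le M 1
      rw [Finset.card_range]
      rw [Fintype.card_fin] at this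
      exact_mod_cast Nat.lt_succ_of_le this
    have h := congrArg (Polynomial.eval 1) (Lagrange.eq_interpolate ht hdeg)
    rw [Lagrange.interpolate_apply, Polynomial.eval_finsetSum] at h
    rw [hP 1, one_smul] at h
    rw [h]
    refine Finset.sum_congr rfl fun i _ => ?_
    rw [Polynomial.eval_mul, Polynomial.eval_C, hP, mul_comm]

theorem det_one_add_pos_of_norm_lt_one {A : W →L[ℝ] W} (hA : ‖A‖ < 1) : 0 < (1 + A).det := by
  have hne : ∀ s ∈ Icc (0 : ℝ) 1, (1 + s • A).det ≠ 0 := by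
    intro s hs h0
    obtain ⟨x, hx, hx0⟩ := Submodule.exists_mem_ne_zero_of_ne_bot
      (LinearMap.det_eq_zero_iff_ker_ne_bot.1 h0)
    have h1 : x + s • A x = 0 := hx
    have h2 : ‖x‖ = ‖s • A x‖ := by
      rw [← norm_neg (s • A x), ← eq_neg_of_add_eq_zero_left h1]
    rw [norm_smul, Real.norm_of_nonneg hs.1] at h2
    have h3 := A.le_opNorm x
    have h4 : 0 < ‖x‖ := norm_pos_iff.2 hx0
    nlinarith [hs.2, norm_nonneg (A x)]
  have hc : ContinuousOn (fun s : ℝ => (1 + s • A).det) (Icc 0 1) := by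
    apply Continuous.continuousOn
    exact ContinuousLinearMap.continuous_det.comp (by fun_prop)
  by_contra hneg
  push Not at hneg
  have := intermediate_value_Icc' zero_le_one hc
  obtain ⟨s, hs, hs0⟩ := this ⟨by simpa using hneg, by simp [ContinuousLinearMap.det]⟩
  exact hne s hs hs0

variable [MeasurableSpace W] [BorelSpace W]

/-- There is no `C¹` retraction of a closed ball onto its boundary sphere. -/
theorem no_smooth_retraction {R : ℝ} (hR : 0 < R) {r : W → W} (hr : ContDiff ℝ 1 r)
    (hsphere : ∀ x, ‖r x‖ = R) (hid : ∀ x, ‖x‖ = R → r x = x) : False := by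
  let B : Set W := Metric.ball 0 R
  let v : W → W := fun x => r x - x
  have hv : ContDiff ℝ 1 v := hr.sub contDiff_id
  obtain ⟨Λ, hΛ⟩ := hv.contDiffOn.exists_lipschitzOnWith one_ne_zero
    (convex_closedBall (0 : W) R) (isCompact_closedBall 0 R)
  have hBc : B ⊆ Metric.closedBall 0 R := Metric.ball_subset_closedBall
  let A : W → W →L[ℝ] W := fderiv ℝ v
  have hA : Continuous A := hv.continuous_fderiv one_ne_zero
  have hAn : ∀ x ∈ B, ‖A x‖ ≤ Λ := fun x hx =>
    norm_fderiv_le_of_lipschitzOn ℝ (Metric.isOpen_ball.mem_nhds hx) (hΛ.mono hBc)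
  have hder : ∀ (t : ℝ) (x : W), HasFDerivAt (fun y => y + t • v y) (1 + t • A x) x := by
    intro t x
    exact (hasFDerivAt_id x).add ((hv.differentiable one_ne_zero x).hasFDerivAt.const_smul t)
  have hsmall : ∀ t : ℝ, 0 < t → t < 1 / (Λ + 1) →
      ∫ x in B, (1 + t • A x).det = (volume B).toReal := by
    intro t ht0 ht1
    have hΛ0 : (0 : ℝ) ≤ Λ := Λ.2
    have htΛ : t * (Λ + 1) < 1 := by rwa [lt_div_iff₀ (by positivity)] at ht1
    have ht : t < 1 := by nlinarith
    let f : W → W := fun y => y + t • v y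
    have hf : Continuous f := by
      have := hv.continuous
      fun_prop
    have happ : ApproximatesLinearOn f (ContinuousLinearEquiv.refl ℝ W : W →L[ℝ] W) B
        (t.toNNReal * Λ) := by
      intro x hx y hy
      have h := (hΛ.mono hBc).norm_sub_le hx hy
      have h2 : f x - f y - (ContinuousLinearEquiv.refl ℝ W : W →L[ℝ] W) (x - y)
          = t • (v x - v y) := by
        simp [f, smul_sub]; abel
      rw [h2, norm_smul, Real.norm_of_nonneg ht0.le]
      push_cast
      rw [Real.coe_toNNReal t ht0.le, mul_assoc]
      gcongr
    have hconst : Subsingleton W ∨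
        t.toNNReal * Λ < ‖((ContinuousLinearEquiv.refl ℝ W).symm : W →L[ℝ] W)‖₊⁻¹ := by
      rcases subsingleton_or_nontrivial W with h | h
      · exact Or.inl h
      · right
        have h1 : ‖((ContinuousLinearEquiv.refl ℝ W).symm : W →L[ℝ] W)‖₊ = 1 := by
          ext
          exact ContinuousLinearMap.norm_id
        rw [h1, inv_one, ← NNReal.coe_lt_coe]
        push_cast
        rw [Real.coe_toNNReal t ht0.le]
        nlinarith
    have hinj : InjOn f B := happ.injOn hconst
    have hopen : IsOpen (f '' B) :=
      (happ.toOpenPartialHomeomorph f B hconst Metric.isOpen_ball).open_target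
    have hfx : ∀ x, f x = (1 - t) • x + t • r x := by
      intro x
      simp only [f, v]
      module
    have hfnorm : ∀ x, ‖f x‖ ≤ (1 - t) * ‖x‖ + t * R := by
      intro x
      rw [hfx]
      refine (norm_add_le _ _).trans ?_
      rw [norm_smul, norm_smul, hsphere, Real.norm_of_nonneg ht0.le,
        Real.norm_of_nonneg (by linarith)]
    have hmaps : f '' B ⊆ B := by
      rintro _ ⟨x, hx, rfl⟩
      rw [mem_ball_zero_iff] at hx ⊢
      refine (hfnorm x).trans_lt ?_
      nlinarith
    have hclosed : closure (f '' B) ∩ B ⊆ f '' B := by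
      rintro y ⟨hy, hyB⟩
      have hcl : IsClosed (f '' Metric.closedBall 0 R) :=
        ((isCompact_closedBall (0 : W) R).image hf).isClosed
      obtain ⟨x, hx, rfl⟩ := closure_minimal (image_mono hBc) hcl hy
      rcases lt_or_eq_of_le (mem_closedBall_zero_iff.1 hx) with h | h
      · exact ⟨x, mem_ball_zero_iff.2 h, rfl⟩
      · have : f x = x := by simp [f, v, hid x h]
        rw [this] at hyB
        exact absurd (mem_ball_zero_iff.1 hyB) (by rw [h]; exact lt_irrefl _)
    have himage : f '' B = B := by
      refine hmaps.antisymm ?_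
      have h0 : (0 : W) ∈ B := by simpa [B] using hR
      exact (convex_ball (0 : W) R).isPreconnected.subset_of_closure_inter_subset hopen
        ⟨f 0, hmaps ⟨0, h0, rfl⟩, 0, h0, rfl⟩ hclosed
    have hpos : ∀ x ∈ B, |(1 + t • A x).det| = (1 + t • A x).det := by
      intro x hx
      refine abs_of_pos (det_one_add_pos_of_norm_lt_one ?_)
      rw [norm_smul, Real.norm_of_nonneg ht0.le]
      nlinarith [hAn x hx]
    have key := integral_image_eq_integral_abs_det_fderiv_smul volume
      (measurableSet_ball : MeasurableSet B)
      (fun x _ => (hder t x).hasFDerivWithinAt) hinj (fun _ => (1 : ℝ))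
    change ∫ _ in f '' B, (1 : ℝ) = _ at key
    rw [himage] at key
    simp only [smul_eq_mul, mul_one] at key
    rw [setIntegral_congr_fun measurableSet_ball hpos] at key
    rw [← key]
    simp [Measure.real]
  have hzero : ∀ x ∈ B, (1 + A x).det = 0 := by
    intro x _
    have h1 : HasFDerivAt r (1 + A x) x := by
      have := hder 1 x
      simpa [v] using this
    have h2 : HasFDerivAt (fun y => inner ℝ (r y) (r y)) (0 : W →L[ℝ] ℝ) x := by
      have : (fun y => inner ℝ (r y) (r y)) = fun _ => R ^ 2 := by
        funext y
        rw [real_inner_self_eq_norm_sq, hsphere]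
      rw [this]
      exact hasFDerivAt_const _ _
    have h3 := (h1.inner ℝ h1).unique h2
    have h4 : ∀ w, inner ℝ (r x) ((1 + A x) w) = 0 := by
      intro w
      have := congrArg (fun l => l w) h3
      simpa [real_inner_comm] using this
    by_contra hdet
    have hunit : IsUnit (LinearMap.det ((1 + A x : W →L[ℝ] W) : W →ₗ[ℝ] W)) :=
      isUnit_iff_ne_zero.2 hdet
    obtain ⟨w, hw⟩ := (LinearEquiv.ofIsUnitDet
      (v := Module.finBasis ℝ W) (v' := Module.finBasis ℝ W)
      (f := ((1 + A x : W →L[ℝ] W) : W →ₗ[ℝ] W)) (by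
        rw [LinearMap.det_toMatrix]; exact hunit)).surjective (r x)
    have h5 := h4 w
    have h6 : (1 + A x) w = r x := hw
    rw [h6, real_inner_self_eq_norm_sq, hsphere] at h5
    exact hR.ne' (pow_eq_zero_iff two_ne_zero |>.1 h5)
  obtain ⟨s, c, t, ht, hc, hdet⟩ := exists_det_one_add_interpolation (W := W)
    (δ := 1 / (Λ + 1)) (by positivity)
  have hint : ∀ i ∈ s, Integrable (fun x => c i * (1 + t i • A x).det) (volume.restrict B) := by
    intro i _
    have hcont : Continuous fun x => c i * (1 + t i • A x).det :=
      continuous_const.mul (ContinuousLinearMap.continuous_det.comp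
        (continuous_const.add (hA.const_smul (t i))))
    exact (hcont.continuousOn.integrableOn_compact (isCompact_closedBall 0 R)).mono_set hBc
  have h1 : ∫ x in B, (1 + A x).det = (volume B).toReal := by
    rw [show (fun x => (1 + A x).det) = fun x => ∑ i ∈ s, c i * (1 + t i • A x).det from
      funext fun x => hdet (A x), integral_finsetSum _ hint]
    calc ∑ i ∈ s, ∫ x in B, c i * (1 + t i • A x).det
        = ∑ i ∈ s, c i * (volume B).toReal := by
          refine Finset.sum_congr rfl fun i hi => ?_
          rw [integral_const_mul, hsmall (t i) (ht i hi).1 (ht i hi).2]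
      _ = _ := by rw [← Finset.sum_mul, hc, one_mul]
  rw [setIntegral_congr_fun measurableSet_ball hzero] at h1
  simp only [integral_zero] at h1
  have h2 : 0 < (volume B).toReal :=
    ENNReal.toReal_pos (Metric.measure_ball_pos volume 0 hR).ne' measure_ball_lt_top.ne
  linarith

/-- A `C¹` self-map of a Euclidean space at bounded distance from the identity is surjective. -/
theorem surjective_of_norm_sub_id_le {f : W → W} (hf : ContDiff ℝ 1 f) {C : ℝ}
    (hC : ∀ x, ‖f x - x‖ ≤ C) : Surjective f := by
  intro y
  by_contra hy
  push Not at hy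
  let C' : ℝ := C + ‖y‖ + 1
  have hC0 : 0 ≤ C := (norm_nonneg _).trans (hC 0)
  have hC' : 0 < C' := by positivity
  let χ : ContDiffBump (0 : W) := ⟨C', C' + 1, hC', by linarith⟩
  let g : W → W := fun x => x + χ x • (f x - y - x)
  have hg : ContDiff ℝ 1 g := contDiff_id.add
    (χ.contDiff.smul ((hf.sub contDiff_const).sub contDiff_id))
  have hg0 : ∀ x, g x ≠ 0 := by
    intro x hx
    have h1 : ‖x‖ = ‖χ x • (f x - y - x)‖ := by
      rw [← norm_neg (χ x • _), ← eq_neg_of_add_eq_zero_left hx]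
    have h2 : ‖f x - y - x‖ ≤ C + ‖y‖ := by
      calc ‖f x - y - x‖ = ‖(f x - x) - y‖ := by congr 1; abel
        _ ≤ ‖f x - x‖ + ‖y‖ := norm_sub_le _ _
        _ ≤ _ := by gcongr; exact hC x
    rw [norm_smul, Real.norm_of_nonneg χ.nonneg] at h1
    have h3 : ‖x‖ ≤ C' := by
      have := mul_le_mul (χ.le_one (x := x)) h2 (norm_nonneg _) zero_le_one
      simp only [C']
      linarith
    have h4 : χ x = 1 := χ.one_of_mem_closedBall (mem_closedBall_zero_iff.2 h3)
    simp only [g, h4, one_smul] at hx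
    apply hy x
    have : f x - y = 0 := by rw [← hx]; abel
    exact sub_eq_zero.1 this
  have hgid : ∀ x, ‖x‖ = C' + 1 → g x = x := by
    intro x hx
    have : χ x = 0 := χ.zero_of_le_dist (by rw [dist_zero_right, hx])
    simp [g, this]
  refine no_smooth_retraction (R := C' + 1) (by linarith)
    (r := fun x => ((C' + 1) * ‖g x‖⁻¹) • g x) ?_ ?_ ?_
  · refine ContDiff.smul (contDiff_const.mul (ContDiff.inv ?_ fun x => norm_ne_zero_iff.2 (hg0 x))) hg
    exact hg.norm ℝ hg0
  · intro x
    rw [norm_smul, norm_mul, norm_inv, norm_norm, mul_assoc,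
      inv_mul_cancel₀ (norm_ne_zero_iff.2 (hg0 x)), mul_one, Real.norm_of_nonneg (by linarith)]
  · intro x hx
    simp only [hgid x hx, hx]
    rw [mul_inv_cancel₀ (by linarith), one_smul]

end Brouwer

section Minimax

variable {X : Type*} [NormedAddCommGroup X] [InnerProductSpace ℝ X]

/-- One gradient descent step with step size `τ` decreases a function with `K`-Lipschitz gradient
by at least `τ / 2` times the squared norm of the gradient. -/
theorem gradient_step_le {F : X → ℝ} {g : X → X} (hF : ∀ x, HasFDerivAt F (innerSL ℝ (g x)) x)
    {K : ℝ} (hK : ∀ x y, ‖g x - g y‖ ≤ K * ‖x - y‖) {τ : ℝ} (hτ : 0 < τ) (hτK : τ * K ≤ 1 / 2)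
    (hK0 : 0 ≤ K) (x : X) : F (x - τ • g x) ≤ F x - τ / 2 * ‖g x‖ ^ 2 := by
  let h : ℝ → ℝ := fun s => F (x - s • g x)
  have hh : ∀ s, HasDerivAt h (inner ℝ (g (x - s • g x)) (-g x)) s := by
    intro s
    have h1 : HasDerivAt (fun s : ℝ => x - s • g x) (-g x) s := by
      simpa using ((hasDerivAt_id s).smul_const (g x)).const_sub x
    exact (hF _).comp_hasDerivAt s h1
  obtain ⟨s, hs, hs'⟩ := exists_hasDerivAt_eq_slope h _ hτ
    (fun s _ => (hh s).continuousAt.continuousWithinAt) (fun s _ => hh s)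
  have h2 : F (x - τ • g x) - F x = τ * inner ℝ (g (x - s • g x)) (-g x) := by
    rw [hs']
    simp only [h, zero_smul, sub_zero]
    field_simp
  have h3 : inner ℝ (g (x - s • g x)) (-g x)
      = -‖g x‖ ^ 2 - inner ℝ (g (x - s • g x) - g x) (g x) := by
    rw [inner_neg_right, inner_sub_left, real_inner_self_eq_norm_sq]
    ring
  have h4 : ‖g (x - s • g x) - g x‖ ≤ 1 / 2 * ‖g x‖ := by
    refine (hK _ _).trans ?_
    rw [sub_sub_cancel_left, norm_neg, norm_smul, Real.norm_of_nonneg hs.1.le, ← mul_assoc]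
    gcongr
    nlinarith [hs.2]
  have h5 := abs_real_inner_le_norm (g (x - s • g x) - g x) (g x)
  have h6 : -inner ℝ (g (x - s • g x) - g x) (g x) ≤ 1 / 2 * ‖g x‖ * ‖g x‖ :=
    (neg_le_abs _).trans (h5.trans (by gcongr))
  nlinarith

variable [FiniteDimensional ℝ X]

/-- Saddle point theorem: a bounded `C^{1,1}` perturbation of a quadratic form that is at least `a`
on the affine positive eigenspace through a point of the kernel has almost critical points at
level at least `a`. -/
theorem exists_almost_critical_point {L : X →L[ℝ] X} (hL : (L : X →ₗ[ℝ] X).IsSymmetric)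
    {R : X → ℝ} {G : X → X} (hR : ∀ x, HasFDerivAt R (innerSL ℝ (G x)) x) (hG : ContDiff ℝ 1 G)
    {Λ : ℝ≥0} (hΛ : LipschitzWith Λ G) {C : ℝ} (hC : ∀ x, ‖G x‖ ≤ C) {b : ℝ} (hb : ∀ x, R x ≤ b)
    {p : X} {a l₀ : ℝ} (hgap : ∀ (μ : ℝ) (v : X), 0 < μ → v ≠ 0 → L v = μ • v → l₀ ≤ μ)
    (hlow : ∀ y, l₀ * ‖y‖ ^ 2 ≤ inner ℝ (L y) y → a ≤ 1 / 2 * inner ℝ (L (p + y)) (p + y) + R (p + y))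
    {η : ℝ} (hη : 0 < η) :
    ∃ x, a ≤ 1 / 2 * inner ℝ (L x) x + R x ∧ ‖L x + G x‖ < η := by
  by_contra! hcon
  let F : X → ℝ := fun x => 1 / 2 * inner ℝ (L x) x + R x
  let g : X → X := fun x => L x + G x
  have hsymm : ∀ x y, inner ℝ (L x) y = inner ℝ x (L y) := fun x y => hL x y
  have hF : ∀ x, HasFDerivAt F (innerSL ℝ (g x)) x := by
    intro x
    have h1 := (((L.hasFDerivAt (x := x)).inner ℝ (hasFDerivAt_id x)).const_mul (1 / 2)).add (hR x)
    refine h1.congr_fderiv ?_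
    ext v
    simp [g]
    rw [hsymm v x, real_inner_comm (L x) v]
    ring
  have hC0 : 0 ≤ C := (norm_nonneg _).trans (hC 0)
  let K : ℝ := ‖L‖ + Λ
  have hK0 : 0 ≤ K := by positivity
  have hK : ∀ x y, ‖g x - g y‖ ≤ K * ‖x - y‖ := by
    intro x y
    have h1 : g x - g y = L (x - y) + (G x - G y) := by simp [g]; abel
    rw [h1, add_mul]
    exact (norm_add_le _ _).trans (add_le_add (L.le_opNorm _) (hΛ.norm_sub_le x y))
  let τ : ℝ := 1 / (2 * (K + 1))
  have hτ : 0 < τ := by positivity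
  have hτK : τ * K ≤ 1 / 2 := by
    simp only [τ]
    rw [div_mul_eq_mul_div, div_le_div_iff₀ (by positivity) (by norm_num)]
    linarith
  let T : X → X := fun x => x - τ • g x
  have hT : ContDiff ℝ 1 T := contDiff_id.sub ((L.contDiff.add hG).const_smul τ)
  have hstep : ∀ x, F (T x) ≤ F x - τ / 2 * ‖g x‖ ^ 2 := gradient_step_le hF hK hτ hτK hK0
  have hiter : ∀ (k : ℕ) (x : X), a ≤ F (T^[k] x) → F (T^[k] x) ≤ F x - k * (τ / 2 * η ^ 2) := by
    intro k
    induction k with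
    | zero => intro x _; simp
    | succ k ih =>
      intro x hx
      rw [iterate_succ_apply'] at hx ⊢
      have h1 := hstep (T^[k] x)
      have h2 : a ≤ F (T^[k] x) := hx.trans (h1.trans (by
        have : 0 ≤ τ / 2 * ‖g (T^[k] x)‖ ^ 2 := by positivity
        linarith))
      have h3 := ih x h2
      have h4 : η ^ 2 ≤ ‖g (T^[k] x)‖ ^ 2 := by
        have := hcon _ h2
        gcongr
      have h5 : τ / 2 * η ^ 2 ≤ τ / 2 * ‖g (T^[k] x)‖ ^ 2 := by gcongr
      push_cast
      linarith
  let e := hL.eigenvectorBasis rfl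
  let l := hL.eigenvalues rfl
  have he : ∀ i, L (e i) = l i • e i := fun i => hL.apply_eigenvectorBasis rfl i
  have hcL : ∀ i x, inner ℝ (e i) (L x) = l i * inner ℝ (e i) x := by
    intro i x
    rw [← hsymm, he, real_inner_smul_left]
  have hquad : ∀ x, inner ℝ (L x) x = ∑ i, l i * inner ℝ (e i) x ^ 2 := by
    intro x
    rw [← e.sum_inner_mul_inner]
    refine Finset.sum_congr rfl fun i _ => ?_
    rw [real_inner_comm, hcL]
    ring
  have hcoord : ∀ (k : ℕ) i, ∃ D : ℝ, ∀ x,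
      |inner ℝ (e i) (T^[k] x) - (1 - τ * l i) ^ k * inner ℝ (e i) x| ≤ D := by
    intro k i
    induction k with
    | zero => exact ⟨0, fun x => by simp⟩
    | succ k ih =>
      obtain ⟨D, hD⟩ := ih
      refine ⟨|1 - τ * l i| * D + τ * C, fun x => ?_⟩
      have h1 : inner ℝ (e i) (T^[k + 1] x) - (1 - τ * l i) ^ (k + 1) * inner ℝ (e i) x
          = (1 - τ * l i) * (inner ℝ (e i) (T^[k] x) - (1 - τ * l i) ^ k * inner ℝ (e i) x)
            - τ * inner ℝ (e i) (G (T^[k] x)) := by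
        rw [iterate_succ_apply']
        simp only [T, g, inner_sub_right, inner_add_right, real_inner_smul_right, hcL]
        ring
      rw [h1]
      refine (abs_sub _ _).trans ?_
      rw [abs_mul, abs_mul, abs_of_pos hτ]
      have h2 : |inner ℝ (e i) (G (T^[k] x))| ≤ C := by
        refine (abs_real_inner_le_norm _ _).trans ?_
        rw [e.norm_eq_one, one_mul]
        exact hC _
      gcongr
      exact hD x
  obtain ⟨k, hk⟩ : ∃ k : ℕ, b - a < k * (τ / 2 * η ^ 2) := by
    obtain ⟨k, hk⟩ := exists_nat_gt ((b - a) / (τ / 2 * η ^ 2))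
    exact ⟨k, by rwa [div_lt_iff₀ (by positivity)] at hk⟩
  choose D hD using hcoord k
  let I := {i // l i ≤ 0}
  let ι : EuclideanSpace ℝ I → X := fun w => ∑ i : I, w i • e i
  have hι : ∀ w (j : I), inner ℝ (e j) (ι w) = w j := by
    intro w j
    simp only [ι, inner_sum, real_inner_smul_right, e.inner_eq_ite]
    rw [Finset.sum_eq_single j]
    · simp
    · intro i _ hij
      rw [if_neg fun h => hij (Subtype.ext h).symm, mul_zero]
    · simp
  have hιF : ∀ w, F (ι w) ≤ b := by
    intro w
    have h1 : inner ℝ (L (ι w)) (ι w) ≤ 0 := by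
      have h2 : L (ι w) = ∑ i : I, (w i * l i) • e i := by
        simp only [ι, map_sum, map_smul, he, smul_smul]
      rw [h2, sum_inner]
      refine Finset.sum_nonpos fun i _ => ?_
      rw [real_inner_smul_left, hι]
      nlinarith [i.2, sq_nonneg (w i)]
    have := hb (ι w)
    simp only [F]
    linarith
  have hone : ∀ i : I, 1 ≤ (1 - τ * l i) ^ k := fun i =>
    one_le_pow₀ (by nlinarith [i.2])
  let f : EuclideanSpace ℝ I → EuclideanSpace ℝ I := fun w =>
    WithLp.toLp 2 fun i : I => ((1 - τ * l i) ^ k)⁻¹ * inner ℝ (e i) (T^[k] (ι w))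
  have hιs : ContDiff ℝ 1 ι := ContDiff.sum fun i _ =>
    ((EuclideanSpace.proj i : EuclideanSpace ℝ I →L[ℝ] ℝ).contDiff).smul contDiff_const
  have hTk : ContDiff ℝ 1 T^[k] :=
    Nat.recOn (motive := fun j => ContDiff ℝ 1 T^[j]) k contDiff_id
      fun j ih => by rw [iterate_succ]; exact ih.comp hT
  have hf : ContDiff ℝ 1 f := by
    rw [contDiff_euclidean]
    intro i
    exact contDiff_const.mul (contDiff_const.inner ℝ (hTk.comp hιs))
  have hfb : ∀ w, ‖f w - w‖ ≤ √(∑ i : I, D i ^ 2) := by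
    intro w
    rw [EuclideanSpace.norm_eq]
    gcongr with i
    have h1 : (f w - w) i = ((1 - τ * l i) ^ k)⁻¹ *
        (inner ℝ (e i) (T^[k] (ι w)) - (1 - τ * l i) ^ k * inner ℝ (e i) (ι w)) := by
      have := hone i
      rw [hι]
      simp only [f, PiLp.sub_apply]
      field_simp
    rw [h1, Real.norm_eq_abs, abs_mul, abs_of_nonneg (by have := hone i; positivity)]
    calc _ ≤ 1 * D i := mul_le_mul (inv_le_one_of_one_le₀ (hone i)) (hD i _) (abs_nonneg _)
          zero_le_one
      _ = D i := one_mul _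
  obtain ⟨w, hw⟩ := surjective_of_norm_sub_id_le hf hfb
    (WithLp.toLp 2 fun i : I => ((1 - τ * l i) ^ k)⁻¹ * inner ℝ (e i) p)
  have hwp : ∀ i : I, inner ℝ (e i) (T^[k] (ι w)) = inner ℝ (e i) p := by
    intro i
    have h1 : f w i = ((1 - τ * l i) ^ k)⁻¹ * inner ℝ (e i) p := by rw [hw]
    exact mul_left_cancel₀ (inv_ne_zero (by have := hone i; positivity)) h1
  let y := T^[k] (ι w) - p
  have hy : ∀ i, l i ≤ 0 → inner ℝ (e i) y = 0 := by
    intro i hi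
    simp only [y, inner_sub_right]
    rw [hwp ⟨i, hi⟩, sub_self]
  have hyq : l₀ * ‖y‖ ^ 2 ≤ inner ℝ (L y) y := by
    rw [hquad, ← e.sum_sq_inner_right, Finset.mul_sum]
    refine Finset.sum_le_sum fun i _ => ?_
    rcases le_or_gt (l i) 0 with h | h
    · simp [hy i h]
    · have := hgap (l i) (e i) h (e.orthonormal.ne_zero i) (he i)
      gcongr
  have h1 : a ≤ F (T^[k] (ι w)) := by
    have := hlow y hyq
    rwa [show p + y = T^[k] (ι w) by simp [y]] at this
  have h2 := hiter k (ι w) h1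
  have h3 := hιF w
  linarith

end Minimax

section SymplecticForm

variable {n : ℕ}

/-- The standard complex structure on `ℝ^{2n}`. -/
def complexStructure (n : ℕ) : E n →L[ℝ] E n :=
  LinearMap.toContinuousLinearMap
    { toFun := fun x => WithLp.toLp 2 (Sum.elim (fun i => -x (Sum.inr i)) fun i => x (Sum.inl i))
      map_add' := fun x y => by
        ext i
        rcases i with i | i <;> simp
        ring
      map_smul' := fun c x => by
        ext i
        rcases i with i | i <;> simp }

@[simp]
theorem complexStructure_inl (x : E n) (i : Fin n) :
    complexStructure n x (Sum.inl i) = -x (Sum.inr i) := rfl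

@[simp]
theorem complexStructure_inr (x : E n) (i : Fin n) :
    complexStructure n x (Sum.inr i) = x (Sum.inl i) := rfl

theorem symp_eq_inner (x y : E n) : symp x y = inner ℝ (complexStructure n x) y := by
  simp only [symp, PiLp.inner_apply, Fintype.sum_sum_type, complexStructure_inl,
    complexStructure_inr, ← Finset.sum_add_distrib]
  refine Finset.sum_congr rfl fun i _ => ?_
  simp
  ring

theorem norm_complexStructure (x : E n) : ‖complexStructure n x‖ = ‖x‖ := by
  simp only [EuclideanSpace.norm_eq, Fintype.sum_sum_type, complexStructure_inl,
    complexStructure_inr, norm_neg]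
  rw [add_comm]

theorem symp_swap (x y : E n) : symp x y = -symp y x := by
  simp only [symp, ← Finset.sum_neg_distrib]
  refine Finset.sum_congr rfl fun i _ => ?_
  ring

theorem symp_self (x : E n) : symp x x = 0 := by linarith [symp_swap x x]

theorem symp_sub_left (x y z : E n) : symp (x - y) z = symp x z - symp y z := by
  simp only [symp_eq_inner, map_sub, inner_sub_left]

theorem symp_neg_left (x z : E n) : symp (-x) z = -symp x z := by
  simp only [symp_eq_inner, map_neg, inner_neg_left]

theorem symp_smul_left (c : ℝ) (x z : E n) : symp (c • x) z = c * symp x z := by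
  simp only [symp_eq_inner, map_smul, real_inner_smul_left]

/-- A vector representing a covector `ℓ` through the symplectic form is no longer than `ℓ`. -/
theorem norm_le_of_symp_eq {x : E n} {ℓ : E n →L[ℝ] ℝ} (h : ∀ v, symp x v = ℓ v) : ‖x‖ ≤ ‖ℓ‖ := by
  rcases eq_or_ne x 0 with rfl | hx
  · simp
  have h1 := h (complexStructure n x)
  rw [symp_eq_inner, real_inner_self_eq_norm_sq, norm_complexStructure] at h1
  have h2 := (le_abs_self _).trans (ℓ.le_opNorm (complexStructure n x))
  rw [norm_complexStructure, ← h1, sq] at h2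
  exact le_of_mul_le_mul_right h2 (norm_pos_iff.2 hx)

end SymplecticForm

section Riesz

variable {X : Type*} [NormedAddCommGroup X] [InnerProductSpace ℝ X]

theorem continuous_inner_apply_self (L : X →L[ℝ] X) : Continuous fun x => inner ℝ (L x) x :=
  L.continuous.inner continuous_id

variable [FiniteDimensional ℝ X]

/-- The Riesz isomorphism of a finite-dimensional real inner product space. -/
def rieszVector (X : Type*) [NormedAddCommGroup X] [InnerProductSpace ℝ X]
    [FiniteDimensional ℝ X] : (X →L[ℝ] ℝ) →L[ℝ] X :=
  ∑ i, (ContinuousLinearMap.apply ℝ ℝ (stdOrthonormalBasis ℝ X i)).smulRight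
    (stdOrthonormalBasis ℝ X i)

theorem inner_rieszVector (ℓ : X →L[ℝ] ℝ) (v : X) : inner ℝ (rieszVector X ℓ) v = ℓ v := by
  simp only [rieszVector, sum_apply, ContinuousLinearMap.smulRight_apply,
    ContinuousLinearMap.apply_apply, sum_inner, real_inner_smul_left]
  conv_rhs => rw [← (stdOrthonormalBasis ℝ X).sum_repr' v, map_sum]
  refine Finset.sum_congr rfl fun i _ => ?_
  rw [map_smul, smul_eq_mul, mul_comm]

theorem norm_rieszVector_le (ℓ : X →L[ℝ] ℝ) : ‖rieszVector X ℓ‖ ≤ ‖ℓ‖ := by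
  rcases (norm_nonneg (rieszVector X ℓ)).eq_or_lt with h | h
  · exact h ▸ norm_nonneg ℓ
  · refine le_of_mul_le_mul_right ?_ h
    rw [← sq, ← real_inner_self_eq_norm_sq, inner_rieszVector]
    exact (le_abs_self _).trans (ℓ.le_opNorm _)

end Riesz

section CompactSupport

variable {F : Type*} [NormedAddCommGroup F] [NormedSpace ℝ F]

theorem exists_lipschitz_fderiv {f : F → ℝ} (hf : ContDiff ℝ 2 f) (hc : HasCompactSupport f) :
    ∃ Λ : ℝ, 0 ≤ Λ ∧ (∀ x y, ‖fderiv ℝ f x - fderiv ℝ f y‖ ≤ Λ * ‖x - y‖) ∧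
      ∀ x, ‖fderiv ℝ f x‖ ≤ Λ := by
  have h1 : ContDiff ℝ 1 (fderiv ℝ f) := hf.fderiv_right (by norm_num)
  obtain ⟨K, hK⟩ := h1.lipschitzWith_of_hasCompactSupport (hc.fderiv (𝕜 := ℝ)) one_ne_zero
  obtain ⟨C, hC⟩ := h1.continuous.bounded_above_of_compact_support (hc.fderiv (𝕜 := ℝ))
  refine ⟨max K C, le_max_of_le_left K.2, fun x y => ?_, fun x => (hC x).trans (le_max_right _ _)⟩
  refine (hK.norm_sub_le x y).trans ?_
  gcongr
  exact le_max_left _ _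

end CompactSupport

section Loops

variable {n N : ℕ}

/-- Discrete loops in `ℝ^{2n}`. -/
abbrev Loop (n N : ℕ) := PiLp 2 fun _ : ZMod N => E n

/-- The constant loop. -/
def constLoop (N : ℕ) (p : E n) : Loop n N := WithLp.toLp 2 fun _ => p

theorem constLoop_apply (p : E n) (i : ZMod N) : constLoop N p i = p := rfl

variable [NeZero N]

theorem sum_zmod_eq_sum_range {β : Type*} [AddCommMonoid β] (f : ZMod N → β) :
    ∑ i, f i = ∑ k ∈ Finset.range N, f (k : ZMod N) := by
  symm
  refine Finset.sum_bij (fun k _ => (k : ZMod N)) (fun _ _ => Finset.mem_univ _) ?_ ?_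
    fun _ _ => rfl
  · intro a ha b hb hab
    have := congrArg ZMod.val hab
    rwa [ZMod.val_cast_of_lt (Finset.mem_range.1 ha),
      ZMod.val_cast_of_lt (Finset.mem_range.1 hb)] at this
  · exact fun i _ => ⟨i.val, Finset.mem_range.2 (ZMod.val_lt i), ZMod.natCast_zmod_val i⟩

/-- The self-adjoint operator whose quadratic form is `x ↦ ∑ ω(xᵢ, xᵢ₊₁)`. -/
def loopOp (n N : ℕ) [NeZero N] : Loop n N →L[ℝ] Loop n N :=
  (PiLp.continuousLinearEquiv 2 ℝ fun _ : ZMod N => E n).symm.toContinuousLinearMap ∘L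
    ContinuousLinearMap.pi fun i =>
      (1 / 2 : ℝ) • (complexStructure n ∘L
        ((PiLp.proj 2 (fun _ : ZMod N => E n) (i - 1) : Loop n N →L[ℝ] E n) -
          PiLp.proj 2 (fun _ : ZMod N => E n) (i + 1)))

theorem loopOp_apply (x : Loop n N) (i : ZMod N) :
    loopOp n N x i = (1 / 2 : ℝ) • complexStructure n (x (i - 1) - x (i + 1)) := rfl

theorem inner_loopOp (x y : Loop n N) : inner ℝ (loopOp n N x) y =
    1 / 2 * ∑ i, (symp (x i) (y (i + 1)) + symp (y i) (x (i + 1))) := by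
  have h1 : ∑ i, symp (x i) (y (i + 1)) = ∑ i, symp (x (i - 1)) (y i) :=
    Fintype.sum_equiv (Equiv.addRight 1) _ _ fun i => by simp
  rw [Finset.sum_add_distrib, h1, ← Finset.sum_add_distrib, PiLp.inner_apply, Finset.mul_sum]
  refine Finset.sum_congr rfl fun i _ => ?_
  rw [loopOp_apply, real_inner_smul_left, ← symp_eq_inner, symp_sub_left, symp_swap (y i)]
  ring

theorem inner_loopOp_self (x : Loop n N) :
    inner ℝ (loopOp n N x) x = ∑ i, symp (x i) (x (i + 1)) := by
  rw [inner_loopOp, Finset.sum_add_distrib]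
  ring

theorem loopOp_isSymmetric : (loopOp n N : Loop n N →ₗ[ℝ] Loop n N).IsSymmetric := by
  intro x y
  change inner ℝ (loopOp n N x) y = inner ℝ x (loopOp n N y)
  rw [real_inner_comm (loopOp n N y), inner_loopOp, inner_loopOp]
  congr 1
  exact Finset.sum_congr rfl fun i _ => add_comm _ _

theorem loopOp_constLoop (p : E n) : loopOp n N (constLoop N p) = 0 := by
  ext1 i
  simp [loopOp_apply, constLoop_apply]

theorem sum_norm_le_sqrt_mul_norm (x : Loop n N) : ∑ i, ‖x i‖ ≤ √N * ‖x‖ := by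
  have h := Finset.sum_mul_sq_le_sq_mul_sq Finset.univ (fun _ => (1 : ℝ)) fun i => ‖x i‖
  have h1 : ‖x‖ ^ 2 = ∑ i, ‖x i‖ ^ 2 := PiLp.norm_sq_eq_of_L2 _ x
  simp only [one_mul, one_pow, Finset.sum_const, Finset.card_univ, ZMod.card, nsmul_eq_mul,
    mul_one, ← h1] at h
  refine le_of_sq_le_sq ?_ (by positivity)
  rw [mul_pow, Real.sq_sqrt (by positivity)]
  exact_mod_cast h

theorem norm_le_of_forall_norm_le {x : Loop n N} {B : ℝ} (hx : ∀ i, ‖x i‖ ≤ B) :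
    ‖x‖ ≤ √N * B := by
  have hB : 0 ≤ B := (norm_nonneg _).trans (hx 0)
  refine le_of_sq_le_sq ?_ (by positivity)
  rw [mul_pow, Real.sq_sqrt (by positivity), PiLp.norm_sq_eq_of_L2]
  calc ∑ i, ‖x i‖ ^ 2 ≤ ∑ _i : ZMod N, B ^ 2 := by
        gcongr with i
        exact hx i
    _ = _ := by simp [ZMod.card]

/-- A discrete Poincaré inequality for loops with an odd number of vertices. -/
theorem norm_sub_le_norm_loopOp (hN : Odd N) (x : Loop n N) (j k : ZMod N) :
    ‖x j - x k‖ ≤ 2 * √N * ‖loopOp n N x‖ := by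
  obtain ⟨q, hq⟩ := hN
  have h2 : (2 : ZMod N) * (q + 1) = 1 := by
    have : ((2 * q + 1 : ℕ) : ZMod N) = 0 := hq ▸ ZMod.natCast_self N
    push_cast at this
    linear_combination this
  let D : ZMod N → ℝ := fun i => ‖x (i - 1) - x (i + 1)‖
  have hD : ∀ i, D i = 2 * ‖loopOp n N x i‖ := by
    intro i
    rw [loopOp_apply, norm_smul, norm_complexStructure]
    simp only [D]
    norm_num
    ring
  have hpath : ∀ m : ℕ, ‖x (k + 2 * m) - x k‖ ≤ ∑ l ∈ Finset.range m, D (k + 2 * l + 1) := by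
    intro m
    induction m with
    | zero => simp
    | succ m ih =>
      rw [Finset.sum_range_succ]
      have h3 : D (k + 2 * m + 1) = ‖x (k + 2 * (m + 1 : ℕ)) - x (k + 2 * m)‖ := by
        have e1 : k + 2 * (m : ZMod N) + 1 - 1 = k + 2 * m := by ring
        have e2 : k + 2 * (m : ZMod N) + 1 + 1 = k + 2 * (m + 1 : ℕ) := by push_cast; ring
        simp only [D]
        rw [norm_sub_rev, e1, e2]
      rw [h3]
      calc ‖x (k + 2 * (m + 1 : ℕ)) - x k‖
          = ‖(x (k + 2 * m) - x k) + (x (k + 2 * (m + 1 : ℕ)) - x (k + 2 * m))‖ := by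
            congr 1; abel
        _ ≤ _ := (norm_add_le _ _).trans (by gcongr)
  let m : ZMod N := (j - k) * (q + 1)
  have hj : j = k + 2 * (m.val : ZMod N) := by
    rw [ZMod.natCast_zmod_val]
    simp only [m]
    linear_combination -(j - k) * h2
  have hsum : ∑ l ∈ Finset.range N, D (k + 2 * l + 1) = ∑ i, D i := by
    rw [← sum_zmod_eq_sum_range fun i => D (k + 2 * i + 1)]
    refine Fintype.sum_bijective (fun i => k + 2 * i + 1) ?_ _ _ fun _ => rfl
    refine Function.bijective_iff_has_inverse.2 ⟨fun i => (q + 1) * (i - k - 1), ?_, ?_⟩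
    · intro i
      linear_combination i * h2
    · intro i
      linear_combination (i - k - 1) * h2
  calc ‖x j - x k‖ ≤ ∑ l ∈ Finset.range m.val, D (k + 2 * l + 1) := by
        conv_lhs => rw [hj]
        exact hpath _
    _ ≤ ∑ l ∈ Finset.range N, D (k + 2 * l + 1) :=
        Finset.sum_le_sum_of_subset_of_nonneg
          (Finset.range_subset_range.2 (ZMod.val_lt m).le) fun _ _ _ => norm_nonneg _
    _ = 2 * ∑ i, ‖loopOp n N x i‖ := by
        rw [hsum, Finset.mul_sum]
        exact Finset.sum_congr rfl fun i _ => hD i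
    _ ≤ _ := by
        rw [mul_assoc]
        gcongr
        exact sum_norm_le_sqrt_mul_norm _

/-- The positive eigenvalues of `loopOp` are bounded below by the inverse of twice the number of
vertices. -/
theorem le_of_loopOp_eigenvector (hNo : Odd N) {μ : ℝ} {x : Loop n N} (hμ : 0 < μ) (hx : x ≠ 0)
    (h : loopOp n N x = μ • x) : 1 / (2 * N) ≤ μ := by
  have hN : (0 : ℝ) < N := Nat.cast_pos.2 (NeZero.pos N)
  have hsum : ∑ i, x i = 0 := by
    have h1 : ∑ i, loopOp n N x i = 0 := by
      simp only [loopOp_apply]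
      rw [← Finset.smul_sum, ← map_sum, Finset.sum_sub_distrib]
      have h2 : ∑ i, x (i - 1) = ∑ i, x i :=
        Fintype.sum_equiv (Equiv.subRight 1) _ _ fun i => by simp
      have h3 : ∑ i, x (i + 1) = ∑ i, x i :=
        Fintype.sum_equiv (Equiv.addRight 1) _ _ fun i => by simp
      rw [h2, h3, sub_self, map_zero, smul_zero]
    simp only [h, PiLp.smul_apply, ← Finset.smul_sum] at h1
    exact (smul_eq_zero.1 h1).resolve_left hμ.ne'
  have hxj : ∀ j, ‖x j‖ ≤ 2 * √N * (μ * ‖x‖) := by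
    intro j
    have h1 : (N : ℝ) • x j = ∑ k, (x j - x k) := by
      rw [Finset.sum_sub_distrib, hsum, sub_zero, Finset.sum_const, Finset.card_univ, ZMod.card,
        ← Nat.cast_smul_eq_nsmul ℝ]
    have h2 : (N : ℝ) * ‖x j‖ ≤ N * (2 * √N * (μ * ‖x‖)) := by
      calc (N : ℝ) * ‖x j‖ = ‖∑ k, (x j - x k)‖ := by
            rw [← h1, norm_smul, Real.norm_of_nonneg hN.le]
        _ ≤ ∑ k, ‖x j - x k‖ := norm_sum_le _ _
        _ ≤ ∑ _k : ZMod N, 2 * √N * (μ * ‖x‖) := by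
            gcongr with k
            have := norm_sub_le_norm_loopOp hNo x j k
            rwa [h, norm_smul, Real.norm_of_nonneg hμ.le] at this
        _ = _ := by simp [ZMod.card]
    exact le_of_mul_le_mul_left h2 hN
  have h3 := norm_le_of_forall_norm_le hxj
  have h4 : √(N : ℝ) * (2 * √N * (μ * ‖x‖)) = (2 * N * μ) * ‖x‖ := by
    have := Real.mul_self_sqrt hN.le
    linear_combination (2 * μ * ‖x‖) * this
  rw [h4] at h3
  have h5 : 0 < ‖x‖ := norm_pos_iff.2 hx
  have h6 : 1 ≤ 2 * N * μ := by
    by_contra! hlt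
    nlinarith
  rw [div_le_iff₀ (by positivity)]
  linarith

end Loops

section CriticalLoops

variable {n N : ℕ}

/-- The midpoint of the `i`-th edge of a loop. -/
def loopMid (i : ZMod N) : Loop n N →L[ℝ] E n :=
  (1 / 2 : ℝ) • ((PiLp.proj 2 (fun _ : ZMod N => E n) i : Loop n N →L[ℝ] E n) +
    PiLp.proj 2 (fun _ : ZMod N => E n) (i + 1))

theorem loopMid_apply (i : ZMod N) (x : Loop n N) :
    loopMid i x = (1 / 2 : ℝ) • (x i + x (i + 1)) := rfl

variable [NeZero N]

/-- The sum of the values of the functions `f i` at the midpoints of the edges of a loop. -/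
def loopPotential (f : ZMod N → E n → ℝ) (x : Loop n N) : ℝ := ∑ i, f i (loopMid i x)

/-- The derivative of `loopPotential`. -/
def loopForceForm (f : ZMod N → E n → ℝ) (x : Loop n N) : Loop n N →L[ℝ] ℝ :=
  ∑ i, (fderiv ℝ (f i) (loopMid i x)).comp (loopMid i)

/-- The gradient of `loopPotential`. -/
def loopForce (f : ZMod N → E n → ℝ) (x : Loop n N) : Loop n N :=
  rieszVector (Loop n N) (loopForceForm f x)

theorem inner_loopForce (f : ZMod N → E n → ℝ) (x v : Loop n N) :
    inner ℝ (loopForce f x) v = ∑ i, fderiv ℝ (f i) (loopMid i x) (loopMid i v) := by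
  rw [loopForce, inner_rieszVector, loopForceForm, sum_apply]
  rfl

theorem hasFDerivAt_loopPotential {f : ZMod N → E n → ℝ} (hf : ∀ i, ContDiff ℝ 2 (f i))
    (x : Loop n N) : HasFDerivAt (loopPotential f) (innerSL ℝ (loopForce f x)) x := by
  have h : HasFDerivAt (loopPotential f) (loopForceForm f x) x := by
    refine HasFDerivAt.fun_sum fun i _ => ?_
    exact (((hf i).differentiable (by norm_num)) _).hasFDerivAt.comp x (loopMid i).hasFDerivAt
  have h2 : innerSL ℝ (loopForce f x) = loopForceForm f x :=
    ContinuousLinearMap.ext fun v => inner_rieszVector (loopForceForm f x) v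
  rwa [h2]

theorem contDiff_loopForce {f : ZMod N → E n → ℝ} (hf : ∀ i, ContDiff ℝ 2 (f i)) :
    ContDiff ℝ 1 (loopForce f) := by
  refine (rieszVector (Loop n N)).contDiff.comp (ContDiff.sum fun i _ => ?_)
  exact (((hf i).fderiv_right (by norm_num)).comp (loopMid i).contDiff).clm_comp contDiff_const

theorem exists_bound_loopForce {f : ZMod N → E n → ℝ} (hf : ∀ i, ContDiff ℝ 2 (f i))
    (hc : ∀ i, HasCompactSupport (f i)) :
    ∃ C : ℝ≥0, LipschitzWith C (loopForce f) ∧ ∀ x, ‖loopForce f x‖ ≤ C := by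
  choose Λ hΛ0 hΛ hΛb using fun i => exists_lipschitz_fderiv (hf i) (hc i)
  let C₁ : ℝ := ∑ i, Λ i * ‖(loopMid i : Loop n N →L[ℝ] E n)‖
  let C₂ : ℝ := ∑ i, Λ i * ‖(loopMid i : Loop n N →L[ℝ] E n)‖ ^ 2
  have h₁ : 0 ≤ C₁ := 
    Finset.sum_nonneg fun i _ => mul_nonneg (hΛ0 i) (norm_nonneg _)
  refine ⟨⟨max C₁ C₂, le_max_of_le_left h₁⟩, LipschitzWith.of_dist_le_mul fun x y => ?_,
    fun x => ?_⟩
  · rw [dist_eq_norm, dist_eq_norm, loopForce, loopForce, ← map_sub]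
    calc ‖rieszVector (Loop n N) (loopForceForm f x - loopForceForm f y)‖
        ≤ ‖loopForceForm f x - loopForceForm f y‖ := norm_rieszVector_le _
      _ ≤ ∑ i, Λ i * ‖(loopMid i : Loop n N →L[ℝ] E n)‖ ^ 2 * ‖x - y‖ := by
          rw [loopForceForm, loopForceForm, ← Finset.sum_sub_distrib]
          refine (norm_sum_le _ _).trans (Finset.sum_le_sum fun i _ => ?_)
          rw [← ContinuousLinearMap.sub_comp]
          refine (ContinuousLinearMap.opNorm_comp_le _ _).trans ?_
          have h := hΛ i (loopMid i x) (loopMid i y)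
          rw [← map_sub] at h
          calc _ ≤ (Λ i * (‖(loopMid i : Loop n N →L[ℝ] E n)‖ * ‖x - y‖)) *
                ‖(loopMid i : Loop n N →L[ℝ] E n)‖ := by
                gcongr
                refine h.trans (mul_le_mul_of_nonneg_left ?_ (hΛ0 i))
                exact ContinuousLinearMap.le_opNorm _ _
            _ = _ := by ring
      _ = C₂ * ‖x - y‖ := by rw [← Finset.sum_mul]
      _ ≤ _ := by
          gcongr
          exact le_max_right _ _
  · calc ‖rieszVector (Loop n N) (loopForceForm f x)‖
        ≤ ‖loopForceForm f x‖ := norm_rieszVector_le _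
      _ ≤ C₁ := by
          refine (norm_sum_le _ _).trans (Finset.sum_le_sum fun i _ => ?_)
          refine (ContinuousLinearMap.opNorm_comp_le _ _).trans ?_
          gcongr
          exact hΛb i _
      _ ≤ _ := le_max_left _ _

theorem exists_le_loopPotential {f : ZMod N → E n → ℝ} (hf : ∀ i, Continuous (f i))
    (hc : ∀ i, HasCompactSupport (f i)) : ∃ b, ∀ x, loopPotential f x ≤ b := by
  choose C hC using fun i => (hf i).bounded_above_of_compact_support (hc i)
  exact ⟨∑ i, C i, fun x => Finset.sum_le_sum fun i _ => (le_abs_self _).trans (hC i _)⟩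

/-- The critical points of the discrete action functional on loops with an odd number of vertices
are the discrete Hamiltonian orbits. -/
theorem symp_sub_eq_fderiv_of_critical (hN : Odd N) {f : ZMod N → E n → ℝ} {x : Loop n N}
    (hx : loopOp n N x + loopForce f x = 0) (i : ZMod N) (v : E n) :
    symp (x (i + 1) - x i) v = fderiv ℝ (f i) (loopMid i x) v := by
  let e : ZMod N → ℝ := fun i =>
    fderiv ℝ (f i) (loopMid i x) v - symp (x (i + 1) - x i) v
  have he : ∀ i, e (i + 1) = -e i := by
    intro j
    let w : Loop n N := WithLp.toLp 2 (Pi.single (j + 1) v)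
    have hw : ∀ k, w k = if k = j + 1 then v else 0 := fun k => Pi.single_apply _ _ _
    have h1 : inner ℝ (loopOp n N x) w = 1 / 2 * symp (x j - x (j + 1 + 1)) v := by
      rw [PiLp.inner_apply, Finset.sum_eq_single (j + 1)]
      · rw [hw, if_pos rfl, loopOp_apply, real_inner_smul_left, ← symp_eq_inner,
          add_sub_cancel_right]
      · intro k _ hk
        rw [hw, if_neg hk, inner_zero_right]
      · simp
    have h2 : inner ℝ (loopForce f x) w = 1 / 2 *
        (fderiv ℝ (f (j + 1)) (loopMid (j + 1) x) v + fderiv ℝ (f j) (loopMid j x) v) := by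
      rw [inner_loopForce]
      simp only [loopMid_apply _ w, map_smul, map_add, smul_eq_mul]
      rw [← Finset.mul_sum, Finset.sum_add_distrib]
      congr 2
      · rw [Finset.sum_eq_single (j + 1)]
        · rw [hw, if_pos rfl]
        · intro k _ hk
          rw [hw, if_neg hk, map_zero]
        · simp
      · rw [Finset.sum_eq_single j]
        · rw [hw, if_pos rfl]
        · intro k _ hk
          rw [hw, if_neg fun h => hk (add_right_cancel h), map_zero]
        · simp
    have h3 : inner ℝ (loopOp n N x + loopForce f x) w = 0 := by rw [hx, inner_zero_left]
    rw [inner_add_left, h1, h2, symp_sub_left] at h3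
    simp only [e, symp_sub_left]
    linarith
  have hpow : ∀ m : ℕ, e (i + m) = (-1) ^ m * e i := by
    intro m
    induction m with
    | zero => simp
    | succ m ih =>
      rw [Nat.cast_succ, ← add_assoc, he, ih, pow_succ]
      ring
  have h := hpow N
  rw [ZMod.natCast_self, add_zero, hN.neg_one_pow] at h
  simp only [e] at h
  linarith

/-- The discrete action functional. -/
def loopAction (f : ZMod N → E n → ℝ) (x : Loop n N) : ℝ :=
  1 / 2 * inner ℝ (loopOp n N x) x + loopPotential f x

theorem continuous_loopPotential {f : ZMod N → E n → ℝ} (hf : ∀ i, Continuous (f i)) :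
    Continuous (loopPotential f : Loop n N → ℝ) :=
  continuous_finsetSum _ fun i _ => (hf i).comp (loopMid i).continuous

theorem continuous_loopAction {f : ZMod N → E n → ℝ} (hf : ∀ i, Continuous (f i)) :
    Continuous (loopAction f : Loop n N → ℝ) := by
  have h := continuous_inner_apply_self (loopOp n N)
  unfold loopAction
  exact (h.const_mul (1 / 2)).add (continuous_loopPotential hf)

theorem inner_loopOp_constLoop (x : Loop n N) (p : E n) :
    inner ℝ (loopOp n N x) (constLoop N p) = 0 := by
  have h := loopOp_isSymmetric (n := n) (N := N) x (constLoop N p)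
  change inner ℝ (loopOp n N x) (constLoop N p) = inner ℝ x (loopOp n N (constLoop N p)) at h
  rw [h, loopOp_constLoop, inner_zero_right]

theorem exists_almost_critical_loop (hN : Odd N) {f : ZMod N → E n → ℝ}
    (hf : ∀ i, ContDiff ℝ 2 (f i)) (hc : ∀ i, HasCompactSupport (f i)) {a : ℝ} {p : E n}
    (hlow : ∀ y : Loop n N, a ≤ 1 / (4 * N) * ‖y‖ ^ 2 + ∑ i, f i (p + loopMid i y))
    {η : ℝ} (hη : 0 < η) : ∃ x, a ≤ loopAction f x ∧ ‖loopOp n N x + loopForce f x‖ < η := by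
  obtain ⟨C, hLip, hC⟩ := exists_bound_loopForce hf hc
  obtain ⟨b, hb⟩ := exists_le_loopPotential (fun i => (hf i).continuous) hc
  refine exists_almost_critical_point loopOp_isSymmetric (hasFDerivAt_loopPotential hf)
    (contDiff_loopForce hf) hLip hC hb (p := constLoop N p) (l₀ := 1 / (2 * N)) ?_ ?_ hη
  · exact fun μ v hμ hv h => le_of_loopOp_eigenvector hN hμ hv h
  · intro y hy
    have hmid : ∀ i : ZMod N, loopMid i (constLoop N p) = p := by
      intro i
      rw [loopMid_apply, constLoop_apply, constLoop_apply]
      module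
    have h2 : loopPotential f (constLoop N p + y) = ∑ i, f i (p + loopMid i y) := by
      simp only [loopPotential, map_add, hmid]
    rw [map_add, loopOp_constLoop, zero_add, inner_add_right, inner_loopOp_constLoop, zero_add, h2]
    have h3 : 1 / (4 * N : ℝ) * ‖y‖ ^ 2 = 1 / 2 * (1 / (2 * N) * ‖y‖ ^ 2) := by
      have : (0 : ℝ) < N := Nat.cast_pos.2 (NeZero.pos N)
      field_simp
      ring
    linarith [hlow y]

theorem loopAction_le_of_outside (hN : Odd N) {f : ZMod N → E n → ℝ} {x : Loop n N}
    (hf : ∀ i, f i (loopMid i x) = 0) (hf' : ∀ i, fderiv ℝ (f i) (loopMid i x) = 0) :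
    loopAction f x ≤ N * ‖loopOp n N x + loopForce f x‖ ^ 2 := by
  have hpot : loopPotential f x = 0 := Finset.sum_eq_zero fun i _ => hf i
  have hforce : loopForce f x = 0 := by
    have : loopForceForm f x = 0 := Finset.sum_eq_zero fun i _ => by
      rw [hf', ContinuousLinearMap.zero_comp]
    rw [loopForce, this, map_zero]
  rw [hforce, add_zero, loopAction, hpot, add_zero]
  have h1 : inner ℝ (loopOp n N x) x = inner ℝ (loopOp n N x) (x - constLoop N (x 0)) := by
    rw [inner_sub_right, inner_loopOp_constLoop, sub_zero]
  have h2 : ‖x - constLoop N (x 0)‖ ≤ √N * (2 * √N * ‖loopOp n N x‖) :=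
    norm_le_of_forall_norm_le fun i => norm_sub_le_norm_loopOp hN x i 0
  have h3 : √(N : ℝ) * (2 * √N * ‖loopOp n N x‖) = 2 * N * ‖loopOp n N x‖ := by
    have := Real.mul_self_sqrt (Nat.cast_nonneg N : (0 : ℝ) ≤ N)
    linear_combination (2 * ‖loopOp n N x‖) * this
  rw [h1]
  calc 1 / 2 * inner ℝ (loopOp n N x) (x - constLoop N (x 0))
      ≤ 1 / 2 * (‖loopOp n N x‖ * (2 * N * ‖loopOp n N x‖)) := by
        gcongr
        refine (real_inner_le_norm _ _).trans ?_
        gcongr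
        exact h2.trans_eq h3
    _ = _ := by ring

theorem exists_forall_lt_norm_eq_zero {ι : Type*} [Finite ι] {f : ι → E n → ℝ}
    (hc : ∀ i, HasCompactSupport (f i)) :
    ∃ ρ, ∀ i z, ρ < ‖z‖ → f i z = 0 ∧ fderiv ℝ (f i) z = 0 := by
  choose ρ hρ using fun i => (hc i).isBounded.exists_norm_le
  obtain ⟨r, hr⟩ := (Set.finite_range ρ).bddAbove
  refine ⟨r, fun i z hz => ?_⟩
  have hz' : z ∉ tsupport (f i) := fun h =>
    absurd ((hρ i z h).trans (hr ⟨i, rfl⟩)) (not_le.2 hz)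
  exact ⟨image_eq_zero_of_notMem_tsupport hz', fderiv_of_notMem_tsupport ℝ hz'⟩

/-- Almost critical points of the discrete action at positive levels stay in a bounded region. -/
theorem exists_bound_almost_critical_loop (hN : Odd N) {f : ZMod N → E n → ℝ}
    (hf : ∀ i, ContDiff ℝ 2 (f i)) (hc : ∀ i, HasCompactSupport (f i)) {a : ℝ} (ha : 0 < a) :
    ∃ η > 0, ∃ B : ℝ, ∀ x : Loop n N, a ≤ loopAction f x →
      ‖loopOp n N x + loopForce f x‖ < η → ‖x‖ ≤ B := by
  have hN0 : (0 : ℝ) < N := Nat.cast_pos.2 (NeZero.pos N)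
  obtain ⟨C, -, hC⟩ := exists_bound_loopForce hf hc
  obtain ⟨ρ, hρ⟩ := exists_forall_lt_norm_eq_zero hc
  let D : ℝ := 2 * √N * (1 + C)
  have hη1 : min 1 (a / (2 * N)) ≤ 1 := min_le_left _ _
  have hη0 : 0 < min 1 (a / (2 * N)) := lt_min one_pos (by positivity)
  refine ⟨min 1 (a / (2 * N)), hη0, √N * (ρ + D + D), fun x hax hx => ?_⟩
  have hD : ∀ j k, ‖x j - x k‖ ≤ D := by
    intro j k
    refine (norm_sub_le_norm_loopOp hN x j k).trans ?_
    refine mul_le_mul_of_nonneg_left ?_ (by positivity)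
    calc ‖loopOp n N x‖ = ‖(loopOp n N x + loopForce f x) - loopForce f x‖ := by
          rw [add_sub_cancel_right]
      _ ≤ _ := (norm_sub_le _ _).trans (add_le_add (hx.le.trans hη1) (hC x))
  have hx0 : ‖x 0‖ ≤ ρ + D := by
    by_contra! hx0
    have hout : ∀ i, ρ < ‖loopMid i x‖ := by
      intro i
      have h1 : ‖loopMid i x - x 0‖ ≤ D := by
        have : loopMid i x - x 0 = (1 / 2 : ℝ) • ((x i - x 0) + (x (i + 1) - x 0)) := by
          rw [loopMid_apply]
          module
        rw [this, norm_smul]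
        have h2 := norm_add_le (x i - x 0) (x (i + 1) - x 0)
        have h3 := hD i 0
        have h4 := hD (i + 1) 0
        norm_num
        linarith
      have h2 := norm_sub_norm_le (x 0) (loopMid i x)
      rw [norm_sub_rev] at h2
      linarith
    have h1 := loopAction_le_of_outside hN (fun i => (hρ i _ (hout i)).1)
      fun i => (hρ i _ (hout i)).2
    have h2 : ‖loopOp n N x + loopForce f x‖ ^ 2 ≤ a / (2 * N) := by
      rw [sq]
      exact (mul_le_mul (hx.le.trans hη1) (hx.le.trans (min_le_right _ _))
        (norm_nonneg _) zero_le_one).trans_eq (one_mul _)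
    have h3 : N * ‖loopOp n N x + loopForce f x‖ ^ 2 ≤ N * (a / (2 * N)) := by gcongr
    have h4 : N * (a / (2 * N)) = a / 2 := by field_simp
    linarith
  refine norm_le_of_forall_norm_le fun i => ?_
  have h2 := hD i 0
  have h3 := norm_sub_norm_le (x i) (x 0)
  linarith

theorem exists_critical_loop (hN : Odd N) {f : ZMod N → E n → ℝ}
    (hf : ∀ i, ContDiff ℝ 2 (f i)) (hc : ∀ i, HasCompactSupport (f i)) {a : ℝ} (ha : 0 < a)
    {p : E n} (hlow : ∀ y : Loop n N, a ≤ 1 / (4 * N) * ‖y‖ ^ 2 + ∑ i, f i (p + loopMid i y)) :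
    ∃ x : Loop n N, loopOp n N x + loopForce f x = 0 ∧ a ≤ loopAction f x := by
  obtain ⟨η, hη, B, hB⟩ := exists_bound_almost_critical_loop hN hf hc ha
  have hseq : ∀ k : ℕ, 0 < η / (k + 1) := fun k => by positivity
  choose x hxa hxη using fun k : ℕ => exists_almost_critical_loop hN hf hc hlow (hseq k)
  have hbdd : ∀ k, x k ∈ Metric.closedBall (0 : Loop n N) B := by
    intro k
    rw [mem_closedBall_zero_iff]
    exact hB _ (hxa k) ((hxη k).trans_le (div_le_self hη.le (by linarith [k.cast_nonneg (α := ℝ)])))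
  obtain ⟨y, -, ψ, hψ, hy⟩ := tendsto_subseq_of_bounded Metric.isBounded_closedBall hbdd
  have hGc : Continuous fun x => ‖loopOp n N x + loopForce f x‖ :=
    ((loopOp n N).continuous.add (contDiff_loopForce hf).continuous).norm
  have hlim : Filter.Tendsto (fun k : ℕ => η / ((k : ℝ) + 1)) Filter.atTop (𝓝 0) := by
    have := tendsto_one_div_add_atTop_nhds_zero_nat (𝕜 := ℝ)
    simpa [div_eq_mul_inv] using this.const_mul η
  have hy0 : ‖loopOp n N y + loopForce f y‖ ≤ 0 :=
    le_of_tendsto_of_tendsto' ((hGc.tendsto y).comp hy) (hlim.comp hψ.tendsto_atTop)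
      fun k => (hxη _).le
  exact ⟨y, norm_le_zero_iff.1 hy0,
    ge_of_tendsto' (((continuous_loopAction fun i => (hf i).continuous).tendsto y).comp hy) fun k => hxa _⟩

/-- Existence of discrete Hamiltonian loops of prescribed positive action. -/
theorem exists_discrete_orbit (hN : Odd N) {f : ZMod N → E n → ℝ} (hf : ∀ i, ContDiff ℝ 2 (f i))
    (hc : ∀ i, HasCompactSupport (f i)) {a : ℝ} (ha : 0 < a) {p : E n}
    (hlow : ∀ y : Loop n N, a ≤ 1 / (4 * N) * ‖y‖ ^ 2 + ∑ i, f i (p + loopMid i y)) :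
    ∃ x : ZMod N → E n,
      (∀ i v, symp (x (i + 1) - x i) v = fderiv ℝ (f i) ((1 / 2 : ℝ) • (x i + x (i + 1))) v) ∧
      a ≤ 1 / 2 * ∑ i, symp (x i) (x (i + 1)) +
        ∑ i, f i ((1 / 2 : ℝ) • (x i + x (i + 1))) := by
  obtain ⟨y, hcrit, hya⟩ := exists_critical_loop hN hf hc ha hlow
  refine ⟨fun i => y i, fun i v => ?_, ?_⟩
  · rw [symp_sub_eq_fderiv_of_critical hN hcrit i v, loopMid_apply]
  · simpa only [loopAction, inner_loopOp_self, loopPotential, loopMid_apply] using hya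

end CriticalLoops

section MidpointSteps

variable {n : ℕ}

/-- One step of the implicit midpoint discretization of the Hamiltonian flow of `-g`. -/
def MidStep (g : E n → ℝ) (x y : E n) : Prop :=
  ∀ v, symp (y - x) v = fderiv ℝ g ((1 / 2 : ℝ) • (x + y)) v

namespace MidStep

variable {g : E n → ℝ} {x y y' : E n}

theorem norm_sub_le (h : MidStep g x y) : ‖y - x‖ ≤ ‖fderiv ℝ g ((1 / 2 : ℝ) • (x + y))‖ :=
  norm_le_of_symp_eq h

theorem reverse (h : MidStep g x y) : MidStep (fun z => -g z) y x := by
  intro v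
  rw [fderiv_fun_neg, neg_apply, add_comm y x, ← h v, ← neg_sub y x, symp_neg_left]

theorem eq_of_lipschitz {Λ : ℝ} (hΛ : Λ < 2)
    (hg : ∀ a b, ‖fderiv ℝ g a - fderiv ℝ g b‖ ≤ Λ * ‖a - b‖)
    (h : MidStep g x y) (h' : MidStep g x y') : y = y' := by
  have h1 : ∀ v, symp (y - y') v = (fderiv ℝ g ((1 / 2 : ℝ) • (x + y)) -
      fderiv ℝ g ((1 / 2 : ℝ) • (x + y'))) v := by
    intro v
    rw [sub_apply, ← h v, ← h' v, ← symp_sub_left]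
    congr 1
    abel
  have h2 := (norm_le_of_symp_eq h1).trans (hg _ _)
  have h3 : (1 / 2 : ℝ) • (x + y) - (1 / 2 : ℝ) • (x + y') = (1 / 2 : ℝ) • (y - y') := by module
  rw [h3, norm_smul] at h2
  norm_num at h2
  have h4 : ‖y - y'‖ ≤ 0 := by nlinarith [norm_nonneg (y - y')]
  exact sub_eq_zero.1 (norm_le_zero_iff.1 h4)

end MidStep

theorem midStep_path_unique {M : ℕ} {g : ℕ → E n → ℝ} {Λ : ℝ} (hΛ : Λ < 2)
    (hg : ∀ j a b, ‖fderiv ℝ (g j) a - fderiv ℝ (g j) b‖ ≤ Λ * ‖a - b‖) {u w : ℕ → E n}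
    (hu : ∀ j < M, MidStep (g j) (u j) (u (j + 1)))
    (hw : ∀ j < M, MidStep (g j) (w j) (w (j + 1))) (h0 : u 0 = w 0) : ∀ j ≤ M, u j = w j := by
  intro j
  induction j with
  | zero => exact fun _ => h0
  | succ j ih =>
    intro hj
    have h1 := hw j hj
    rw [← ih (Nat.le_of_succ_le hj)] at h1
    exact (hu j hj).eq_of_lipschitz hΛ (hg j) h1

theorem midStep_path_reverse {M : ℕ} {g : ℕ → E n → ℝ} {u : ℕ → E n}
    (hu : ∀ j < M, MidStep (g j) (u j) (u (j + 1))) (j : ℕ) (hj : j < M) :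
    MidStep (fun z => -g (M - 1 - j) z) (u (M - j)) (u (M - (j + 1))) := by
  have h := (hu (M - 1 - j) (by omega)).reverse
  have e1 : M - 1 - j + 1 = M - j := by omega
  have e2 : M - 1 - j = M - (j + 1) := by omega
  rw [e1] at h
  rwa [← e2]

theorem norm_sub_le_sum_norm_steps {V : Type*} [SeminormedAddCommGroup V] (u : ℕ → V) {M i j : ℕ}
    (hi : i ≤ M) (hj : j ≤ M) : ‖u i - u j‖ ≤ ∑ k ∈ Finset.range M, ‖u (k + 1) - u k‖ := by
  wlog hij : j ≤ i generalizing i j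
  · rw [norm_sub_rev]
    exact this hj hi (le_of_not_ge hij)
  rw [← Finset.sum_Ico_sub u hij]
  refine (norm_sum_le _ _).trans (Finset.sum_le_sum_of_subset_of_nonneg ?_ fun _ _ _ =>
    norm_nonneg _)
  intro k hk
  rw [Finset.mem_Ico] at hk
  exact Finset.mem_range.2 (hk.2.trans_le hi)

/-- Closed midpoint paths of a Hamiltonian with small second derivative are constant. -/
theorem midStep_closed_path_const {M : ℕ} {g : E n → ℝ} {Λ : ℝ} (hΛ : M * Λ < 1) (hΛ0 : 0 ≤ Λ)
    (hg : ∀ a b, ‖fderiv ℝ g a - fderiv ℝ g b‖ ≤ Λ * ‖a - b‖) {u : ℕ → E n}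
    (hu : ∀ j < M, MidStep g (u j) (u (j + 1))) (hM : u M = u 0) : ∀ j ≤ M, u j = u 0 := by
  set T := ∑ k ∈ Finset.range M, ‖u (k + 1) - u k‖ with hT
  have hd : ∀ i < M, ∀ j < M, ‖(u (i + 1) - u i) - (u (j + 1) - u j)‖ ≤ Λ * T := by
    intro i hi j hj
    have h1 : ∀ v, symp ((u (i + 1) - u i) - (u (j + 1) - u j)) v =
        (fderiv ℝ g ((1 / 2 : ℝ) • (u i + u (i + 1))) -
          fderiv ℝ g ((1 / 2 : ℝ) • (u j + u (j + 1)))) v := by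
      intro v
      rw [sub_apply, ← hu i hi v, ← hu j hj v, ← symp_sub_left]
    refine ((norm_le_of_symp_eq h1).trans (hg _ _)).trans ?_
    refine mul_le_mul_of_nonneg_left ?_ hΛ0
    have h2 : (1 / 2 : ℝ) • (u i + u (i + 1)) - (1 / 2 : ℝ) • (u j + u (j + 1)) =
        (1 / 2 : ℝ) • ((u i - u j) + (u (i + 1) - u (j + 1))) := by module
    rw [h2, norm_smul]
    have h3 := norm_sub_le_sum_norm_steps u hi.le hj.le
    have h4 := norm_sub_le_sum_norm_steps u (Nat.succ_le_of_lt hi) (Nat.succ_le_of_lt hj)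
    have h5 := norm_add_le (u i - u j) (u (i + 1) - u (j + 1))
    norm_num
    simp only [Nat.succ_eq_add_one, ← hT] at h3 h4
    linarith
  have hsum : ∑ j ∈ Finset.range M, (u (j + 1) - u j) = 0 := by
    rw [Finset.sum_range_sub, hM, sub_self]
  have hstep : ∀ i < M, ‖u (i + 1) - u i‖ ≤ Λ * T := by
    intro i hi
    have hM0 : (0 : ℝ) < M := Nat.cast_pos.2 (by omega)
    refine le_of_mul_le_mul_left ?_ hM0
    have h1 : (M : ℝ) • (u (i + 1) - u i) =
        ∑ j ∈ Finset.range M, ((u (i + 1) - u i) - (u (j + 1) - u j)) := by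
      rw [Finset.sum_sub_distrib, hsum, sub_zero, Finset.sum_const, Finset.card_range,
        Nat.cast_smul_eq_nsmul]
    calc M * ‖u (i + 1) - u i‖ = ‖(M : ℝ) • (u (i + 1) - u i)‖ := by
          rw [norm_smul, Real.norm_of_nonneg hM0.le]
      _ ≤ ∑ j ∈ Finset.range M, Λ * T := by
          rw [h1]
          exact (norm_sum_le _ _).trans
            (Finset.sum_le_sum fun j hj => hd i hi j (Finset.mem_range.1 hj))
      _ = M * (Λ * T) := by simp
  have hT0 : T ≤ 0 := by
    have h1 : T ≤ ∑ k ∈ Finset.range M, Λ * T :=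
      Finset.sum_le_sum fun k hk => hstep k (Finset.mem_range.1 hk)
    simp only [Finset.sum_const, Finset.card_range, nsmul_eq_mul] at h1
    have h2 : 0 ≤ T := Finset.sum_nonneg fun _ _ => norm_nonneg _
    nlinarith
  intro j hj
  have h1 := (norm_sub_le_sum_norm_steps u hj (Nat.zero_le M)).trans hT0
  exact sub_eq_zero.1 (norm_le_zero_iff.1 h1)

/-- A nonconstant midpoint path of a Hamiltonian supported in a ball and with small gradient stays
in the concentric ball of twice the radius. -/
theorem midStep_path_mem_closedBall {M : ℕ} {g : E n → ℝ} {p : E n} {ρ : ℝ}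
    (hsupp : ∀ z ∉ Metric.closedBall p ρ, fderiv ℝ g z = 0)
    (hsmall : ∀ z, M * ‖fderiv ℝ g z‖ ≤ ρ) {u : ℕ → E n}
    (hu : ∀ j < M, MidStep g (u j) (u (j + 1))) (hne : u M ≠ u 0) :
    ∀ i ≤ M, u i ∈ Metric.closedBall p (2 * ρ) := by
  obtain ⟨j, hj, hjne⟩ : ∃ j < M, u (j + 1) ≠ u j := by
    by_contra! hcon
    refine hne ?_
    have h1 : ∀ j ≤ M, u j = u 0 := by
      intro j
      induction j with
      | zero => exact fun _ => rfl
      | succ j ih => exact fun hj => (hcon j hj).trans (ih (Nat.le_of_succ_le hj))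
    exact h1 M le_rfl
  have hM0 : (0 : ℝ) < M := Nat.cast_pos.2 (by omega)
  have hz : (1 / 2 : ℝ) • (u j + u (j + 1)) ∈ Metric.closedBall p ρ := by
    by_contra hz
    have h1 := (hu j hj).norm_sub_le
    rw [hsupp _ hz, norm_zero] at h1
    exact hjne (sub_eq_zero.1 (norm_le_zero_iff.1 h1))
  have hlen : ∑ k ∈ Finset.range M, ‖u (k + 1) - u k‖ ≤ ρ := by
    calc ∑ k ∈ Finset.range M, ‖u (k + 1) - u k‖ ≤ ∑ k ∈ Finset.range M, ρ / M := by
          refine Finset.sum_le_sum fun k hk => ?_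
          rw [le_div_iff₀' hM0]
          exact (mul_le_mul_of_nonneg_left (hu k (Finset.mem_range.1 hk)).norm_sub_le
            hM0.le).trans (hsmall _)
      _ = ρ := by
          simp only [Finset.sum_const, Finset.card_range, nsmul_eq_mul]
          field_simp
  intro i hi
  have h1 := (norm_sub_le_sum_norm_steps u hi hj.le).trans hlen
  have h2 := (norm_sub_le_sum_norm_steps u hi (Nat.succ_le_of_lt hj)).trans hlen
  rw [mem_closedBall_iff_norm] at hz ⊢
  have h3 : u i - p = (1 / 2 : ℝ) • ((u i - u j) + (u i - u (j + 1))) +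
      ((1 / 2 : ℝ) • (u j + u (j + 1)) - p) := by module
  rw [h3]
  refine (norm_add_le _ _).trans ?_
  rw [norm_smul]
  have h4 := norm_add_le (u i - u j) (u i - u (j + 1))
  norm_num at h2 ⊢
  norm_num at hz
  linarith

/-- The contribution of one edge to the discrete action. -/
def edgeAction (g : E n → ℝ) (x y : E n) : ℝ :=
  1 / 2 * symp x y + g ((1 / 2 : ℝ) • (x + y))

theorem edgeAction_self (g : E n → ℝ) (x : E n) : edgeAction g x x = g x := by
  rw [edgeAction, symp_self, mul_zero, zero_add, ← two_smul ℝ x, smul_smul]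
  norm_num

theorem edgeAction_neg_add_edgeAction (g : E n → ℝ) (x y : E n) :
    edgeAction (fun z => -g z) x y + edgeAction g y x = 0 := by
  rw [edgeAction, edgeAction, add_comm y x, symp_swap y x]
  ring

/-- The action of a closed discrete orbit that follows a Hamiltonian `S`, the Hamiltonians `k j`,
then `S` again, and then the Hamiltonians `k j` backwards, is at most the maximum of `S`, as soon as
the support of `S` is displaced by the Hamiltonians `k j`. -/
theorem sum_edgeAction_le {M : ℕ} (hM : 0 < M) {S : E n → ℝ} {k : ℕ → E n → ℝ} {p : E n}
    {ρ m κ Λ : ℝ} (hSm : ∀ z, S z ≤ m) (hS : ∀ z ∉ Metric.closedBall p ρ, S z = 0) (hρ : 0 ≤ ρ)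
    (hS' : ∀ z ∉ Metric.closedBall p ρ, fderiv ℝ S z = 0) (hSρ : ∀ z, ‖fderiv ℝ S z‖ ≤ ρ)
    (hκ0 : 0 ≤ κ) (hκ : κ < 1) (hSκ : ∀ a b, ‖fderiv ℝ S a - fderiv ℝ S b‖ ≤ κ * ‖a - b‖)
    (hSd : Differentiable ℝ S)
    (hΛ : Λ < 2) (hk : ∀ j a b, ‖fderiv ℝ (k j) a - fderiv ℝ (k j) b‖ ≤ Λ * ‖a - b‖)
    (hdisp : ∀ u : ℕ → E n, u 0 ∈ Metric.closedBall p (2 * ρ) →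
      (∀ j < M, MidStep (fun z => -k j z) (u j) (u (j + 1))) → u M ∉ Metric.closedBall p (2 * ρ))
    {x : ℕ → E n} (hA : ∀ j < M, MidStep (fun z => (1 / M : ℝ) * S z) (x j) (x (j + 1)))
    (hB : ∀ j < M, MidStep (fun z => -k j z) (x (M + j)) (x (M + j + 1)))
    (hC : ∀ j < M, MidStep (fun z => (1 / M : ℝ) * S z) (x (M + M + j)) (x (M + M + j + 1)))
    (hD : ∀ j < M, MidStep (k (M - 1 - j)) (x (M + M + M + j)) (x (M + M + M + j + 1)))
    (hx : x (M + M + M + M) = x 0) :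
    ∑ j ∈ Finset.range M, edgeAction (fun z => (1 / M : ℝ) * S z) (x j) (x (j + 1)) +
    ∑ j ∈ Finset.range M, edgeAction (fun z => -k j z) (x (M + j)) (x (M + j + 1)) +
    ∑ j ∈ Finset.range M,
      edgeAction (fun z => (1 / M : ℝ) * S z) (x (M + M + j)) (x (M + M + j + 1)) +
    ∑ j ∈ Finset.range M,
      edgeAction (k (M - 1 - j)) (x (M + M + M + j)) (x (M + M + M + j + 1)) ≤ m := by
  have hM0 : (0 : ℝ) < M := Nat.cast_pos.2 hM
  have hsd : ∀ z, fderiv ℝ (fun z => (1 / M : ℝ) * S z) z = (1 / M : ℝ) • fderiv ℝ S z :=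
    fun z => fderiv_const_mul (hSd z) _
  have hsκ : ∀ a b, ‖fderiv ℝ (fun z => (1 / M : ℝ) * S z) a -
      fderiv ℝ (fun z => (1 / M : ℝ) * S z) b‖ ≤ κ / M * ‖a - b‖ := by
    intro a b
    rw [hsd, hsd, ← smul_sub, norm_smul, Real.norm_of_nonneg (by positivity)]
    calc 1 / M * ‖fderiv ℝ S a - fderiv ℝ S b‖ ≤ 1 / M * (κ * ‖a - b‖) := by
          gcongr
          exact hSκ a b
      _ = _ := by ring
  have hsmall : ∀ z, M * ‖fderiv ℝ (fun z => (1 / M : ℝ) * S z) z‖ ≤ ρ := by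
    intro z
    rw [hsd, norm_smul, Real.norm_of_nonneg (by positivity), ← mul_assoc, mul_one_div_cancel hM0.ne',
      one_mul]
    exact hSρ z
  have hssupp : ∀ z ∉ Metric.closedBall p ρ, fderiv ℝ (fun z => (1 / M : ℝ) * S z) z = 0 := by
    intro z hz
    rw [hsd, hS' z hz, smul_zero]
  have hMκ : M * (κ / M) < 1 := by
    rw [mul_div_cancel₀ _ hM0.ne']
    exact hκ
  have hκM : 0 ≤ κ / M := by positivity
  have hkneg : ∀ j a b, ‖fderiv ℝ (fun z => -k j z) a - fderiv ℝ (fun z => -k j z) b‖ ≤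
      Λ * ‖a - b‖ := by
    intro j a b
    rw [fderiv_fun_neg, fderiv_fun_neg, ← neg_sub', norm_neg]
    exact hk j a b
  have hballs : Metric.closedBall p ρ ⊆ Metric.closedBall p (2 * ρ) :=
    Metric.closedBall_subset_closedBall (by linarith)
  have hw : ∀ j < M, MidStep (fun z => -k j z) (x (M + M + M + (M - j)))
      (x (M + M + M + (M - (j + 1)))) := by
    intro j hj
    have h := midStep_path_reverse (u := fun j => x (M + M + M + j)) hD j hj
    have e : M - 1 - (M - 1 - j) = j := by omega
    rwa [e] at h
  by_cases hx0 : x M = x 0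
  · have hconstA := midStep_closed_path_const hMκ hκM hsκ hA hx0
    have huw : ∀ j ≤ M, x (M + j) = x (M + M + M + (M - j)) :=
      midStep_path_unique (u := fun j => x (M + j)) (w := fun j => x (M + M + M + (M - j)))
        hΛ hkneg hB hw (hx0.trans hx.symm)
    have h23 : x (M + M + M) = x (M + M) := by
      have := huw M le_rfl
      rw [Nat.sub_self, add_zero] at this
      exact this.symm
    have hconstC := midStep_closed_path_const (u := fun j => x (M + M + j)) hMκ hκM hsκ hC h23
    have hsumA : ∑ j ∈ Finset.range M, edgeAction (fun z => (1 / M : ℝ) * S z) (x j) (x (j + 1)) =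
        S (x 0) := by
      rw [Finset.sum_congr rfl (g := fun _ => (1 / M : ℝ) * S (x 0))]
      · rw [Finset.sum_const, Finset.card_range, nsmul_eq_mul]
        field_simp
      · intro j hj
        have hj := Finset.mem_range.1 hj
        rw [hconstA j hj.le, hconstA (j + 1) hj, edgeAction_self]
    have hsumC : ∑ j ∈ Finset.range M,
        edgeAction (fun z => (1 / M : ℝ) * S z) (x (M + M + j)) (x (M + M + j + 1)) =
        S (x (M + M)) := by
      rw [Finset.sum_congr rfl (g := fun _ => (1 / M : ℝ) * S (x (M + M)))]
      · rw [Finset.sum_const, Finset.card_range, nsmul_eq_mul]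
        field_simp
      · intro j hj
        have hj := Finset.mem_range.1 hj
        have h1 : x (M + M + j) = x (M + M) := hconstC j hj.le
        have h2 : x (M + M + j + 1) = x (M + M) := hconstC (j + 1) hj
        rw [h1, h2, edgeAction_self]
    have hsumBD : ∑ j ∈ Finset.range M, edgeAction (fun z => -k j z) (x (M + j)) (x (M + j + 1)) +
        ∑ j ∈ Finset.range M,
          edgeAction (k (M - 1 - j)) (x (M + M + M + j)) (x (M + M + M + j + 1)) = 0 := by
      rw [← Finset.sum_range_reflect (fun j =>
        edgeAction (k (M - 1 - j)) (x (M + M + M + j)) (x (M + M + M + j + 1))),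
        ← Finset.sum_add_distrib]
      refine Finset.sum_eq_zero fun j hj => ?_
      have hj := Finset.mem_range.1 hj
      have h1 := huw j hj.le
      have h2 := huw (j + 1) hj
      have e1 : M - 1 - (M - 1 - j) = j := by omega
      have e2 : M - 1 - j = M - (j + 1) := by omega
      have e3 : M + M + M + (M - (j + 1)) + 1 = M + M + M + (M - j) := by omega
      rw [e1, e2, e3, ← h1, ← h2]
      exact edgeAction_neg_add_edgeAction _ _ _
    have hend : S (x 0) + S (x (M + M)) ≤ m := by
      by_cases hmem : x M ∈ Metric.closedBall p (2 * ρ)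
      · have h1 := hdisp (fun j => x (M + j)) hmem hB
        rw [hS (x (M + M)) fun h => h1 (hballs h), add_zero]
        exact hSm _
      · rw [hx0] at hmem
        rw [hS (x 0) fun h => hmem (hballs h), zero_add]
        exact hSm _
    linarith
  · exfalso
    have hxM := midStep_path_mem_closedBall hssupp hsmall hA hx0 M le_rfl
    have h2M := hdisp (fun j => x (M + j)) hxM hB
    have h23 : x (M + M + M) = x (M + M) := by
      by_contra hne
      exact h2M (midStep_path_mem_closedBall (u := fun j => x (M + M + j)) hssupp hsmall hC hne 0
        (Nat.zero_le M))
    have h1 := midStep_path_unique hΛ (fun j a b => by simpa only [neg_neg] using hk (M - 1 - j) a b)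
      (midStep_path_reverse (u := fun j => x (M + j)) hB)
      (midStep_path_reverse (u := fun j => x (M + M + M + (M - j))) hw)
      (by simpa using h23.symm) M le_rfl
    simp only [Nat.sub_self, add_zero, Nat.sub_zero] at h1
    exact hx0 (h1.trans hx)

end MidpointSteps

section DisplacementEnergy

variable {n : ℕ}

theorem sum_range_four_blocks {M : ℕ} (h : ℕ → ℝ) :
    ∑ i ∈ Finset.range (M + M + M + M + 1), h i =
      ∑ j ∈ Finset.range M, h j + ∑ j ∈ Finset.range M, h (M + j) +
      ∑ j ∈ Finset.range M, h (M + M + j) + ∑ j ∈ Finset.range M, h (M + M + M + j) +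
      h (M + M + M + M) := by
  rw [Finset.sum_range_succ, Finset.sum_range_add, Finset.sum_range_add, Finset.sum_range_add]

theorem sum_norm_loopMid_sq_le {N : ℕ} [NeZero N] (y : Loop n N) :
    ∑ i, ‖loopMid i y‖ ^ 2 ≤ ‖y‖ ^ 2 := by
  have h1 : ∀ i, ‖loopMid i y‖ ^ 2 ≤ 1 / 2 * (‖y i‖ ^ 2 + ‖y (i + 1)‖ ^ 2) := by
    intro i
    rw [loopMid_apply, norm_smul, mul_pow]
    have h2 : ‖y i + y (i + 1)‖ ^ 2 ≤ (‖y i‖ + ‖y (i + 1)‖) ^ 2 := by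
      gcongr
      exact norm_add_le _ _
    norm_num
    nlinarith [sq_nonneg (‖y i‖ - ‖y (i + 1)‖)]
  have h3 : ∑ i, ‖y (i + 1)‖ ^ 2 = ∑ i, ‖y i‖ ^ 2 :=
    Fintype.sum_equiv (Equiv.addRight 1) _ _ fun i => by simp
  refine (Finset.sum_le_sum fun i _ => h1 i).trans ?_
  rw [← Finset.mul_sum, Finset.sum_add_distrib, h3, PiLp.norm_sq_eq_of_L2]
  linarith

/-- The Hamiltonians used to detect displacement: `S`, then the `k j`, then `S`, then the `k j`
backwards, then nothing. -/
def concatHamiltonian (M : ℕ) (S : E n → ℝ) (k : ℕ → E n → ℝ) (i : ℕ) : E n → ℝ :=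
  if i < M then fun z => (1 / M : ℝ) * S z
  else if i < M + M then fun z => -k (i - M) z
  else if i < M + M + M then fun z => (1 / M : ℝ) * S z
  else if i < M + M + M + M then k (M - 1 - (i - (M + M + M)))
  else fun _ => 0

section Concat

variable {M : ℕ} {S : E n → ℝ} {k : ℕ → E n → ℝ} {j : ℕ}

theorem concatHamiltonian_first (hj : j < M) :
    concatHamiltonian M S k j = fun z => (1 / M : ℝ) * S z := if_pos hj

theorem concatHamiltonian_second (hj : j < M) :
    concatHamiltonian M S k (M + j) = fun z => -k j z := by
  rw [concatHamiltonian, if_neg (by omega), if_pos (by omega), Nat.add_sub_cancel_left]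

theorem concatHamiltonian_third (hj : j < M) :
    concatHamiltonian M S k (M + M + j) = fun z => (1 / M : ℝ) * S z := by
  rw [concatHamiltonian, if_neg (by omega), if_neg (by omega), if_pos (by omega)]

theorem concatHamiltonian_fourth (hj : j < M) :
    concatHamiltonian M S k (M + M + M + j) = k (M - 1 - j) := by
  rw [concatHamiltonian, if_neg (by omega), if_neg (by omega), if_neg (by omega),
    if_pos (by omega), Nat.add_sub_cancel_left]

theorem concatHamiltonian_last : concatHamiltonian M S k (M + M + M + M) = fun _ => 0 := by
  rw [concatHamiltonian, if_neg (by omega), if_neg (by omega), if_neg (by omega),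
    if_neg (by omega)]

theorem contDiff_concatHamiltonian (hS : ContDiff ℝ 2 S) (hk : ∀ j, ContDiff ℝ 2 (k j)) (i : ℕ) :
    ContDiff ℝ 2 (concatHamiltonian M S k i) := by
  have h1 : ContDiff ℝ 2 fun z => (1 / M : ℝ) * S z := contDiff_const.mul hS
  unfold concatHamiltonian
  split_ifs
  exacts [h1, (hk _).neg, h1, hk _, contDiff_const]

theorem hasCompactSupport_concatHamiltonian (hS : HasCompactSupport S)
    (hk : ∀ j, HasCompactSupport (k j)) (i : ℕ) :
    HasCompactSupport (concatHamiltonian M S k i) := by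
  have h1 : HasCompactSupport fun z => (1 / M : ℝ) * S z := hS.mul_left
  unfold concatHamiltonian
  split_ifs
  exacts [h1, (hk _).neg, h1, hk _, HasCompactSupport.zero]

theorem le_sum_concatHamiltonian (hM : 0 < M) {p : E n} {m : ℝ} {c : ℕ → ℝ}
    (hSlow : ∀ v, m - ‖v‖ ^ 2 / 20 ≤ S (p + v)) (hc : ∀ j z, |k j z| ≤ c j) (v : ℕ → E n) :
    2 * m - 2 * ∑ j ∈ Finset.range M, c j ≤
      ∑ i ∈ Finset.range (M + M + M + M + 1),
        (1 / (20 * M) * ‖v i‖ ^ 2 + concatHamiltonian M S k i (p + v i)) := by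
  have hM0 : (0 : ℝ) < M := Nat.cast_pos.2 hM
  have hs : ∀ w, m / M ≤ 1 / (20 * M) * ‖w‖ ^ 2 + 1 / M * S (p + w) := by
    intro w
    have h := mul_le_mul_of_nonneg_left (hSlow w) (one_div_nonneg.2 hM0.le)
    have e : 1 / (M : ℝ) * (m - ‖w‖ ^ 2 / 20) = m / M - 1 / (20 * M) * ‖w‖ ^ 2 := by
      field_simp
    linarith
  have hpos : ∀ w : E n, 0 ≤ 1 / (20 * M : ℝ) * ‖w‖ ^ 2 := fun w => by positivity
  have hconst : ∑ j ∈ Finset.range M, m / M = m := by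
    simp only [Finset.sum_const, Finset.card_range, nsmul_eq_mul]
    field_simp
  have hA : m ≤ ∑ j ∈ Finset.range M,
      (1 / (20 * M) * ‖v j‖ ^ 2 + concatHamiltonian M S k j (p + v j)) := by
    refine hconst.symm.trans_le (Finset.sum_le_sum fun j hj => ?_)
    rw [concatHamiltonian_first (Finset.mem_range.1 hj)]
    exact hs _
  have hB : -∑ j ∈ Finset.range M, c j ≤ ∑ j ∈ Finset.range M,
      (1 / (20 * M) * ‖v (M + j)‖ ^ 2 + concatHamiltonian M S k (M + j) (p + v (M + j))) := by
    rw [← Finset.sum_neg_distrib]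
    refine Finset.sum_le_sum fun j hj => ?_
    rw [concatHamiltonian_second (Finset.mem_range.1 hj)]
    linarith [hpos (v (M + j)), (abs_le.1 (hc j (p + v (M + j)))).2]
  have hC : m ≤ ∑ j ∈ Finset.range M,
      (1 / (20 * M) * ‖v (M + M + j)‖ ^ 2 +
        concatHamiltonian M S k (M + M + j) (p + v (M + M + j))) := by
    refine hconst.symm.trans_le (Finset.sum_le_sum fun j hj => ?_)
    rw [concatHamiltonian_third (Finset.mem_range.1 hj)]
    exact hs _
  have hD : -∑ j ∈ Finset.range M, c j ≤ ∑ j ∈ Finset.range M,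
      (1 / (20 * M) * ‖v (M + M + M + j)‖ ^ 2 +
        concatHamiltonian M S k (M + M + M + j) (p + v (M + M + M + j))) := by
    rw [← Finset.sum_range_reflect c, ← Finset.sum_neg_distrib]
    refine Finset.sum_le_sum fun j hj => ?_
    rw [concatHamiltonian_fourth (Finset.mem_range.1 hj)]
    linarith [hpos (v (M + M + M + j)), (abs_le.1 (hc (M - 1 - j) (p + v (M + M + M + j)))).1]
  have hE : 0 ≤ 1 / (20 * M) * ‖v (M + M + M + M)‖ ^ 2 +
      concatHamiltonian M S k (M + M + M + M) (p + v (M + M + M + M)) := by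
    rw [concatHamiltonian_last, add_zero]
    exact hpos _
  rw [sum_range_four_blocks]
  linarith

end Concat

/-- A sequence of small Hamiltonians cannot displace the support of a bump function whose height
exceeds twice their total size. -/
theorem exists_midStep_path_mem_closedBall {M : ℕ} (hM : 0 < M) {S : E n → ℝ}
    {k : ℕ → E n → ℝ} {p : E n} {ρ m κ Λ : ℝ} {c : ℕ → ℝ} (hS2 : ContDiff ℝ 2 S)
    (hSsupp : tsupport S ⊆ Metric.closedBall p ρ) (hρ : 0 ≤ ρ) (hSm : ∀ z, S z ≤ m)
    (hSlow : ∀ v, m - ‖v‖ ^ 2 / 20 ≤ S (p + v)) (hSρ : ∀ z, ‖fderiv ℝ S z‖ ≤ ρ)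
    (hκ0 : 0 ≤ κ) (hκ : κ < 1) (hSκ : ∀ a b, ‖fderiv ℝ S a - fderiv ℝ S b‖ ≤ κ * ‖a - b‖)
    (hk2 : ∀ j, ContDiff ℝ 2 (k j)) (hkc : ∀ j, HasCompactSupport (k j)) (hΛ : Λ < 2)
    (hkΛ : ∀ j a b, ‖fderiv ℝ (k j) a - fderiv ℝ (k j) b‖ ≤ Λ * ‖a - b‖)
    (hc : ∀ j z, |k j z| ≤ c j) (hcm : 2 * ∑ j ∈ Finset.range M, c j < m) :
    ∃ u : ℕ → E n, u 0 ∈ Metric.closedBall p (2 * ρ) ∧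
      (∀ j < M, MidStep (fun z => -k j z) (u j) (u (j + 1))) ∧
      u M ∈ Metric.closedBall p (2 * ρ) := by
  by_contra! hdisp
  have hM0 : (1 : ℝ) ≤ M := Nat.one_le_cast.2 hM
  set N := M + M + M + M + 1 with hN
  have hNcast : (N : ℝ) = 4 * M + 1 := by
    rw [hN]
    push_cast
    ring
  have : NeZero N := ⟨by omega⟩
  have hNodd : Odd N := ⟨2 * M, by omega⟩
  set g := concatHamiltonian M S k with hg
  have hval : ∀ i < N, ((i : ZMod N)).val = i := fun i hi => ZMod.val_cast_of_lt hi
  have hScomp : HasCompactSupport S :=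
    (isCompact_closedBall p ρ).of_isClosed_subset (isClosed_tsupport S) hSsupp
  have hcpos : 0 ≤ ∑ j ∈ Finset.range M, c j :=
    Finset.sum_nonneg fun j _ => (abs_nonneg _).trans (hc j 0)
  obtain ⟨x, hx, hax⟩ := exists_discrete_orbit hNodd (f := fun i => g i.val) (p := p)
    (a := 2 * m - 2 * ∑ j ∈ Finset.range M, c j)
    (fun i => contDiff_concatHamiltonian hS2 hk2 _)
    (fun i => hasCompactSupport_concatHamiltonian hScomp hkc _) (by linarith) (by
      intro y
      have h1 := le_sum_concatHamiltonian hM hSlow hc fun i => loopMid (i : ZMod N) y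
      have h2 : ∑ i : ZMod N, (1 / (20 * M) * ‖loopMid i y‖ ^ 2 + g i.val (p + loopMid i y)) =
          ∑ i ∈ Finset.range N, (1 / (20 * M) * ‖loopMid (i : ZMod N) y‖ ^ 2 +
            g i (p + loopMid (i : ZMod N) y)) := by
        rw [sum_zmod_eq_sum_range]
        exact Finset.sum_congr rfl fun i hi => by rw [hval i (Finset.mem_range.1 hi)]
      rw [← h2, Finset.sum_add_distrib, ← Finset.mul_sum] at h1
      have h3 : 1 / (20 * M : ℝ) * ∑ i : ZMod N, ‖loopMid i y‖ ^ 2 ≤ 1 / (4 * N) * ‖y‖ ^ 2 := by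
        have h4 : 1 / (20 * M : ℝ) ≤ 1 / (4 * N) :=
          one_div_le_one_div_of_le (by positivity) (by rw [hNcast]; linarith)
        exact mul_le_mul h4 (sum_norm_loopMid_sq_le y)
          (Finset.sum_nonneg fun i _ => sq_nonneg _) (by positivity)
      linarith)
  set X : ℕ → E n := fun i => x (i : ZMod N) with hX
  have hstep : ∀ i < N, MidStep (g i) (X i) (X (i + 1)) := by
    intro i hi v
    have h := hx (i : ZMod N) v
    rw [hval i hi] at h
    simpa only [hX, Nat.cast_add, Nat.cast_one] using h
  have hXN : X (M + M + M + M + 1) = X 0 := by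
    simp only [hX]
    rw [← hN, ZMod.natCast_self, Nat.cast_zero]
  have hX4 : X (M + M + M + M) = X 0 := by
    have h := (hstep (M + M + M + M) (by omega)).norm_sub_le
    rw [hg, concatHamiltonian_last, fderiv_const_apply, norm_zero, norm_le_zero_iff,
      sub_eq_zero, hXN] at h
    exact h.symm
  have haction : 1 / 2 * ∑ i, symp (x i) (x (i + 1)) +
      ∑ i : ZMod N, g i.val ((1 / 2 : ℝ) • (x i + x (i + 1))) =
      ∑ i ∈ Finset.range N, edgeAction (g i) (X i) (X (i + 1)) := by
    rw [Finset.mul_sum, ← Finset.sum_add_distrib, sum_zmod_eq_sum_range]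
    refine Finset.sum_congr rfl fun i hi => ?_
    rw [hval i (Finset.mem_range.1 hi)]
    simp only [edgeAction, hX, Nat.cast_add, Nat.cast_one]
  have hlast : edgeAction (g (M + M + M + M)) (X (M + M + M + M)) (X (M + M + M + M + 1)) = 0 := by
    rw [hX4, hXN, edgeAction_self, hg, concatHamiltonian_last]
  rw [haction, hN, sum_range_four_blocks, hlast, add_zero] at hax
  have hle := sum_edgeAction_le hM (S := S) (k := k) (x := X) hSm
    (fun z hz => image_eq_zero_of_notMem_tsupport fun h => hz (hSsupp h)) hρ
    (fun z hz => fderiv_of_notMem_tsupport ℝ fun h => hz (hSsupp h)) hSρ hκ0 hκ hSκ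
    (hS2.differentiable (by norm_num)) hΛ hkΛ hdisp
    (fun j hj => by
      have h := hstep j (by omega)
      rwa [hg, concatHamiltonian_first hj] at h)
    (fun j hj => by
      have h := hstep (M + j) (by omega)
      rwa [hg, concatHamiltonian_second hj] at h)
    (fun j hj => by
      have h := hstep (M + M + j) (by omega)
      rwa [hg, concatHamiltonian_third hj] at h)
    (fun j hj => by
      have h := hstep (M + M + M + j) (by omega)
      rwa [hg, concatHamiltonian_fourth hj] at h) hX4
  have hcongr : ∑ j ∈ Finset.range M, edgeAction (g j) (X j) (X (j + 1)) +
      ∑ j ∈ Finset.range M, edgeAction (g (M + j)) (X (M + j)) (X (M + j + 1)) +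
      ∑ j ∈ Finset.range M, edgeAction (g (M + M + j)) (X (M + M + j)) (X (M + M + j + 1)) +
      ∑ j ∈ Finset.range M,
        edgeAction (g (M + M + M + j)) (X (M + M + M + j)) (X (M + M + M + j + 1)) ≤ m := by
    refine le_of_eq_of_le ?_ hle
    congr 1
    · congr 1
      · congr 1
        · exact Finset.sum_congr rfl fun j hj => by
            rw [hg, concatHamiltonian_first (Finset.mem_range.1 hj)]
        · exact Finset.sum_congr rfl fun j hj => by
            rw [hg, concatHamiltonian_second (Finset.mem_range.1 hj)]
      · exact Finset.sum_congr rfl fun j hj => by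
          rw [hg, concatHamiltonian_third (Finset.mem_range.1 hj)]
    · exact Finset.sum_congr rfl fun j hj => by
        rw [hg, concatHamiltonian_fourth (Finset.mem_range.1 hj)]
  linarith

end DisplacementEnergy

section TimeDependent

variable {n : ℕ}

/-- Uniform Lipschitz bounds on `[0, 1]` for a time-dependent Hamiltonian and its differential. -/
structure HamiltonianBounds (K : ℝ → E n → ℝ) (Λ : ℝ) : Prop where
  nonneg : 0 ≤ Λ
  norm_fderiv_le : ∀ t ∈ Icc (0 : ℝ) 1, ∀ x, ‖fderiv ℝ (K t) x‖ ≤ Λ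
  norm_fderiv_sub_le : ∀ s ∈ Icc (0 : ℝ) 1, ∀ t ∈ Icc (0 : ℝ) 1, ∀ x y,
    ‖fderiv ℝ (K s) x - fderiv ℝ (K t) y‖ ≤ Λ * (|s - t| + ‖x - y‖)
  abs_sub_le : ∀ s ∈ Icc (0 : ℝ) 1, ∀ t ∈ Icc (0 : ℝ) 1, ∀ x, |K s x - K t x| ≤ Λ * |s - t|

theorem contDiff_slice {K : ℝ → E n → ℝ} (hK : ContDiff ℝ 2 (uncurry K)) (t : ℝ) :
    ContDiff ℝ 2 (K t) :=
  hK.comp (contDiff_const.prodMk contDiff_id)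

theorem exists_hamiltonianBounds {K : ℝ → E n → ℝ} (hK : ContDiff ℝ 2 (uncurry K))
    {C : Set (E n)} (hC : IsCompact C) (hKC : ∀ t, ∀ x ∉ C, K t x = 0) :
    ∃ Λ, HamiltonianBounds K Λ := by
  let χ : ContDiffBump (0 : ℝ) := ⟨2, 3, by norm_num, by norm_num⟩
  let H : ℝ × E n → ℝ := fun q => χ q.1 * uncurry K q
  have hH : ContDiff ℝ 2 H := (χ.contDiff.comp contDiff_fst).mul hK
  have hHc : HasCompactSupport H := by
    refine HasCompactSupport.intro ((isCompact_closedBall (0 : ℝ) 3).prod hC) fun q hq => ?_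
    rw [mem_prod, not_and_or] at hq
    rcases hq with hq | hq
    · have : χ q.1 = 0 := χ.zero_of_le_dist (le_of_lt (not_le.1 hq))
      simp only [H, this, zero_mul]
    · simp only [H, uncurry, hKC _ _ hq, mul_zero]
  have hHK : ∀ t ∈ Icc (0 : ℝ) 1, ∀ x, H (t, x) = K t x := by
    intro t ht x
    have : χ t = 1 := χ.one_of_mem_closedBall (by
      rw [mem_closedBall_zero_iff, Real.norm_eq_abs, abs_of_nonneg ht.1]
      exact ht.2.trans one_le_two)
    simp only [H, uncurry, this, one_mul]
  obtain ⟨Λ, hΛ0, hΛ, hΛb⟩ := exists_lipschitz_fderiv hH hHc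
  have hHd : Differentiable ℝ H := hH.differentiable (by norm_num)
  have hfd : ∀ t ∈ Icc (0 : ℝ) 1, ∀ x, fderiv ℝ (K t) x =
      (fderiv ℝ H (t, x)).comp (ContinuousLinearMap.inr ℝ ℝ (E n)) := by
    intro t ht x
    have h1 : K t = H ∘ fun y => (t, y) := funext fun y => (hHK t ht y).symm
    rw [h1]
    exact ((hHd (t, x)).hasFDerivAt.comp x (hasFDerivAt_prodMk_right t x)).fderiv
  have hcomp : ∀ L : ℝ × E n →L[ℝ] ℝ, ‖L.comp (ContinuousLinearMap.inr ℝ ℝ (E n))‖ ≤ ‖L‖ := by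
    intro L
    refine ContinuousLinearMap.opNorm_le_bound _ (norm_nonneg _) fun v => ?_
    refine (L.le_opNorm _).trans_eq ?_
    simp [Prod.norm_def]
  refine ⟨Λ, hΛ0, fun t ht x => ?_, fun s hs t ht x y => ?_, fun s hs t ht x => ?_⟩
  · rw [hfd t ht]
    exact (hcomp _).trans (hΛb _)
  · rw [hfd s hs, hfd t ht, ← ContinuousLinearMap.sub_comp]
    refine ((hcomp _).trans (hΛ _ _)).trans (mul_le_mul_of_nonneg_left ?_ hΛ0)
    rw [Prod.mk_sub_mk, Prod.norm_def, Real.norm_eq_abs]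
    exact max_le_add_of_nonneg (abs_nonneg _) (norm_nonneg _)
  · rw [← hHK s hs, ← hHK t ht, ← Real.norm_eq_abs]
    refine (convex_univ.norm_image_sub_le_of_norm_fderiv_le (fun q _ => hHd q)
      (fun q _ => hΛb q) (mem_univ (t, x)) (mem_univ (s, x))).trans_eq ?_
    simp [Prod.norm_def]

/-- One step of the midpoint method compared with the Hamiltonian flow. -/
theorem norm_midStep_sub_flow_le {K : ℝ → E n → ℝ} {Λ : ℝ} (hK : HamiltonianBounds K Λ)
    (hKd : ∀ t, Differentiable ℝ (K t)) {γ : ℝ → E n}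
    (hγ : ∀ t ∈ Icc (0 : ℝ) 1, ∃ v', HasDerivAt γ v' t ∧
      ∀ v, symp v' v = -(fderiv ℝ (K t) (γ t) v))
    {t h : ℝ} (ht : 0 ≤ t) (hh : 0 ≤ h) (hth : t + h ≤ 1) {x y : E n}
    (hxy : MidStep (fun z => -(h * K t z)) x y) :
    ‖y - γ (t + h)‖ ≤ (1 + h * Λ) * ‖x - γ t‖ + h ^ 2 * (Λ * (1 + 2 * Λ)) := by
  have hΛ0 := hK.nonneg
  choose! γ' hγ' hγω using hγ
  have hsub : Icc t (t + h) ⊆ Icc (0 : ℝ) 1 := Icc_subset_Icc ht hth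
  have htI : t ∈ Icc t (t + h) := left_mem_Icc.2 (by linarith)
  have hthI : t + h ∈ Icc t (t + h) := right_mem_Icc.2 (by linarith)
  have hγ'b : ∀ s ∈ Icc (0 : ℝ) 1, ‖γ' s‖ ≤ Λ := by
    intro s hs
    have h1 : ∀ v, symp (γ' s) v = (-(fderiv ℝ (K s) (γ s))) v := fun v => hγω s hs v
    refine (norm_le_of_symp_eq h1).trans ?_
    rw [norm_neg]
    exact hK.norm_fderiv_le s hs _
  have hγlip : ∀ s ∈ Icc t (t + h), ‖γ s - γ t‖ ≤ Λ * h := by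
    intro s hs
    refine ((convex_Icc t (t + h)).norm_image_sub_le_of_norm_hasDerivWithin_le
      (fun r hr => (hγ' r (hsub hr)).hasDerivWithinAt) (fun r hr => hγ'b r (hsub hr)) htI
      hs).trans ?_
    rw [Real.norm_of_nonneg (by linarith [hs.1])]
    exact mul_le_mul_of_nonneg_left (by linarith [hs.2]) hΛ0
  have hdev : ∀ s ∈ Icc t (t + h), ‖γ' s - γ' t‖ ≤ Λ * (h + Λ * h) := by
    intro s hs
    have h1 : ∀ v, symp (γ' s - γ' t) v =
        (fderiv ℝ (K t) (γ t) - fderiv ℝ (K s) (γ s)) v := by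
      intro v
      rw [symp_sub_left, hγω s (hsub hs), hγω t (hsub htI), sub_apply]
      ring
    refine (norm_le_of_symp_eq h1).trans
      ((hK.norm_fderiv_sub_le t (hsub htI) s (hsub hs) _ _).trans ?_)
    refine mul_le_mul_of_nonneg_left (add_le_add ?_ ?_) hΛ0
    · rw [abs_sub_comm, abs_of_nonneg (by linarith [hs.1])]
      linarith [hs.2]
    · rw [norm_sub_rev]
      exact hγlip s hs
  have hflow : ‖γ (t + h) - γ t - h • γ' t‖ ≤ Λ * (h + Λ * h) * h := by
    have h1 := (convex_Icc t (t + h)).norm_image_sub_le_of_norm_hasDerivWithin_le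
      (f := fun s => γ s - s • γ' t) (f' := fun s => γ' s - γ' t) (fun r hr => by
        have h2 := (hasDerivAt_id' r).smul_const (γ' t)
        rw [one_smul] at h2
        exact ((hγ' r (hsub hr)).sub h2).hasDerivWithinAt) hdev htI hthI
    rw [add_sub_cancel_left, Real.norm_of_nonneg hh] at h1
    refine le_of_eq_of_le ?_ h1
    congr 1
    module
  have hfd : ∀ z, fderiv ℝ (fun z => -(h * K t z)) z = -(h • fderiv ℝ (K t) z) := by
    intro z
    rw [fderiv_fun_neg, fderiv_const_mul (hKd t z)]
  set z := (1 / 2 : ℝ) • (x + y) with hz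
  have hyx : ‖y - x‖ ≤ h * Λ := by
    refine hxy.norm_sub_le.trans ?_
    rw [hfd, norm_neg, norm_smul, Real.norm_of_nonneg hh]
    exact mul_le_mul_of_nonneg_left (hK.norm_fderiv_le t (hsub htI) _) hh
  have hzx : ‖z - γ t‖ ≤ ‖x - γ t‖ + h * Λ := by
    have h1 : z - γ t = (x - γ t) + (1 / 2 : ℝ) • (y - x) := by
      rw [hz]
      module
    rw [h1]
    refine (norm_add_le _ _).trans (add_le_add le_rfl ?_)
    rw [norm_smul]
    norm_num
    linarith [norm_nonneg (y - x)]
  have hstep : ‖y - x - h • γ' t‖ ≤ h * (Λ * (‖x - γ t‖ + h * Λ)) := by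
    have h1 : ∀ v, symp (y - x - h • γ' t) v =
        (h • (fderiv ℝ (K t) (γ t) - fderiv ℝ (K t) z)) v := by
      intro v
      rw [symp_sub_left, hxy v, hfd, symp_smul_left, hγω t (hsub htI)]
      simp only [smul_apply, sub_apply, neg_apply, smul_eq_mul]
      ring
    refine (norm_le_of_symp_eq h1).trans ?_
    rw [norm_smul, Real.norm_of_nonneg hh]
    refine mul_le_mul_of_nonneg_left ?_ hh
    refine (hK.norm_fderiv_sub_le t (hsub htI) t (hsub htI) _ _).trans ?_
    rw [sub_self, abs_zero, zero_add, norm_sub_rev]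
    exact mul_le_mul_of_nonneg_left hzx hΛ0
  have hdecomp : y - γ (t + h) = (x - γ t) + ((y - x - h • γ' t) -
      (γ (t + h) - γ t - h • γ' t)) := by abel
  rw [hdecomp]
  calc _ ≤ ‖x - γ t‖ + (‖y - x - h • γ' t‖ + ‖γ (t + h) - γ t - h • γ' t‖) :=
        (norm_add_le _ _).trans (add_le_add le_rfl (norm_sub_le _ _))
    _ ≤ ‖x - γ t‖ + (h * (Λ * (‖x - γ t‖ + h * Λ)) + Λ * (h + Λ * h) * h) := by gcongr
    _ = _ := by ring

/-- Convergence of the midpoint method. -/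
theorem norm_midStep_path_sub_flow_le {K : ℝ → E n → ℝ} {Λ : ℝ} (hK : HamiltonianBounds K Λ)
    (hKd : ∀ t, Differentiable ℝ (K t)) {γ : ℝ → E n}
    (hγ : ∀ t ∈ Icc (0 : ℝ) 1, ∃ v', HasDerivAt γ v' t ∧
      ∀ v, symp v' v = -(fderiv ℝ (K t) (γ t) v))
    {M : ℕ} (hM : 0 < M) {u : ℕ → E n} (hu0 : u 0 = γ 0)
    (hu : ∀ j < M, MidStep (fun z => -(1 / M * K (j / M) z)) (u j) (u (j + 1))) :
    ‖u M - γ 1‖ ≤ Real.exp Λ * (Λ * (1 + 2 * Λ)) / M := by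
  have hΛ0 := hK.nonneg
  have hM0 : (0 : ℝ) < M := Nat.cast_pos.2 hM
  set c := Λ * (1 + 2 * Λ)
  have hc : 0 ≤ c := by positivity
  have hind : ∀ j ≤ M, ‖u j - γ (j / M)‖ ≤ (1 + 1 / M * Λ) ^ j * (j * ((1 / M) ^ 2 * c)) := by
    intro j
    induction j with
    | zero => simp [hu0]
    | succ j ih =>
      intro hj
      have hjM : (j : ℝ) + 1 ≤ M := by exact_mod_cast hj
      have e : ((j + 1 : ℕ) : ℝ) / M = j / M + 1 / M := by push_cast; ring
      have h1 := norm_midStep_sub_flow_le hK hKd hγ (t := j / M) (h := 1 / M) (by positivity)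
        (by positivity) (by rw [← add_div, div_le_one hM0]; exact hjM) (hu j hj)
      rw [e]
      refine h1.trans ?_
      have h2 : 1 ≤ (1 + 1 / M * Λ) ^ (j + 1) := one_le_pow₀ (by
        have : 0 ≤ 1 / M * Λ := by positivity
        linarith)
      have h3 : 0 ≤ (1 / (M : ℝ)) ^ 2 * c := by positivity
      calc (1 + 1 / M * Λ) * ‖u j - γ (j / M)‖ + (1 / M) ^ 2 * c
          ≤ (1 + 1 / M * Λ) * ((1 + 1 / M * Λ) ^ j * (j * ((1 / M) ^ 2 * c))) +
            (1 + 1 / M * Λ) ^ (j + 1) * ((1 / M) ^ 2 * c) :=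
            add_le_add (mul_le_mul_of_nonneg_left (ih (Nat.le_of_succ_le hj)) (by positivity))
              (le_mul_of_one_le_left h3 h2)
        _ = _ := by push_cast; ring
  have h1 := hind M le_rfl
  rw [div_self hM0.ne'] at h1
  refine h1.trans ?_
  have h2 : (1 + 1 / M * Λ) ^ M ≤ Real.exp Λ := by
    calc (1 + 1 / M * Λ) ^ M ≤ Real.exp (1 / M * Λ) ^ M := by
          gcongr
          linarith [Real.add_one_le_exp (1 / M * Λ)]
      _ = Real.exp Λ := by
          rw [← Real.exp_nat_mul]
          congr 1
          field_simp
  have h3 : M * ((1 / (M : ℝ)) ^ 2 * c) = c / M := by field_simp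
  rw [h3, mul_div_assoc (Real.exp Λ)]
  exact mul_le_mul_of_nonneg_right h2 (div_nonneg hc hM0.le)

/-- Riemann sums of the Hofer norm. -/
theorem sum_iSup_abs_le {K : ℝ → E n → ℝ} {Λ : ℝ} (hK : HamiltonianBounds K Λ)
    (hb : ∀ t, BddAbove (range fun x => |K t x|)) {M : ℕ} (hM : 0 < M) :
    ∑ j ∈ Finset.range M, 1 / M * ⨆ x, |K (j / M) x| ≤
      (∫ t in (0 : ℝ)..1, ⨆ x, |K t x|) + Λ / M := by
  have hM0 : (0 : ℝ) < M := Nat.cast_pos.2 hM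
  have hΛ0 := hK.nonneg
  set κ : ℝ → ℝ := fun t => ⨆ x, |K t x| with hκ
  have hle : ∀ s ∈ Icc (0 : ℝ) 1, ∀ t ∈ Icc (0 : ℝ) 1, κ s ≤ κ t + Λ * |s - t| := by
    intro s hs t ht
    refine ciSup_le fun x => ?_
    have h1 := le_ciSup (hb t) x
    have h2 := hK.abs_sub_le s hs t ht x
    have h3 := abs_sub_abs_le_abs_sub (K s x) (K t x)
    simp only [hκ]
    linarith
  have hcont : ContinuousOn κ (Icc 0 1) := by
    have : LipschitzOnWith Λ.toNNReal κ (Icc 0 1) := LipschitzOnWith.of_dist_le_mul fun s hs t ht => by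
      rw [Real.dist_eq, Real.dist_eq, Real.coe_toNNReal _ hΛ0, abs_le]
      have h1 := hle s hs t ht
      have h2 := hle t ht s hs
      rw [abs_sub_comm] at h2
      exact ⟨by linarith, by linarith⟩
    exact this.continuousOn
  have hpt : ∀ j : ℕ, j ≤ M → (j / M : ℝ) ∈ Icc (0 : ℝ) 1 := fun j hj =>
    ⟨by positivity, (div_le_one hM0).2 (by exact_mod_cast hj)⟩
  have hmono : ∀ j : ℕ, (j / M : ℝ) ≤ ((j + 1 : ℕ) : ℝ) / M := fun j => by
    gcongr
    exact j.le_succ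
  have hsub : ∀ j < M, Icc (j / M : ℝ) ((j + 1 : ℕ) / M) ⊆ Icc 0 1 := fun j hj =>
    Icc_subset_Icc (hpt j hj.le).1 (hpt (j + 1) hj).2
  have hint : ∀ j < M, IntervalIntegrable κ volume (j / M : ℝ) ((j + 1 : ℕ) / M) := by
    intro j hj
    refine ContinuousOn.intervalIntegrable ?_
    rw [uIcc_of_le (hmono j)]
    exact hcont.mono (hsub j hj)
  have hsum : ∑ j ∈ Finset.range M, ∫ t in (j / M : ℝ)..((j + 1 : ℕ) / M), κ t =
      ∫ t in (0 : ℝ)..1, κ t := by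
    have h := intervalIntegral.sum_integral_adjacent_intervals (a := fun j : ℕ => (j / M : ℝ)) hint
    simpa [hM0.ne'] using h
  have hone : ∀ j < M, 1 / M * κ (j / M) - 1 / M * (Λ / M) ≤
      ∫ t in (j / M : ℝ)..((j + 1 : ℕ) / M), κ t := by
    intro j hj
    have hlen : ((j + 1 : ℕ) / M : ℝ) - j / M = 1 / M := by push_cast; ring
    have h1 : ∫ _t in (j / M : ℝ)..((j + 1 : ℕ) / M), (κ (j / M) - Λ / M) ≤
        ∫ t in (j / M : ℝ)..((j + 1 : ℕ) / M), κ t := by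
      refine intervalIntegral.integral_mono_on (hmono j) intervalIntegrable_const (hint j hj) ?_
      intro t ht
      have h2 := hle _ (hpt j hj.le) t (hsub j hj ht)
      have h3 : |j / M - t| ≤ 1 / M := by
        rw [abs_sub_comm, abs_of_nonneg (by linarith [ht.1])]
        linarith [ht.2]
      have h4 : Λ * |j / M - t| ≤ Λ * (1 / M) := mul_le_mul_of_nonneg_left h3 hΛ0
      have h5 : Λ * (1 / M) = Λ / M := by ring
      linarith
    rw [intervalIntegral.integral_const, hlen, smul_eq_mul] at h1
    linarith
  have h := Finset.sum_le_sum fun j hj => hone j (Finset.mem_range.1 hj)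
  rw [hsum, Finset.sum_sub_distrib, Finset.sum_const, Finset.card_range, nsmul_eq_mul,
    ← mul_assoc, mul_one_div_cancel hM0.ne', one_mul] at h
  linarith

end TimeDependent

section MainTheorem

variable {n : ℕ}

/-- A small smooth bump function centred at `p`, as used in `exists_midStep_path_mem_closedBall`. -/
theorem exists_small_bump (p : E n) {ρ : ℝ} (hρ : 0 < ρ) :
    ∃ (S : E n → ℝ) (m κ : ℝ), 0 < m ∧ 0 ≤ κ ∧ κ < 1 ∧ ContDiff ℝ 2 S ∧
      tsupport S ⊆ Metric.closedBall p ρ ∧ (∀ z, S z ≤ m) ∧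
      (∀ v, m - ‖v‖ ^ 2 / 20 ≤ S (p + v)) ∧ (∀ z, ‖fderiv ℝ S z‖ ≤ ρ) ∧
      ∀ a b, ‖fderiv ℝ S a - fderiv ℝ S b‖ ≤ κ * ‖a - b‖ := by
  let b : ContDiffBump p := ⟨ρ / 2, ρ, by linarith, by linarith⟩
  have hb2 : ContDiff ℝ 2 b := b.contDiff
  obtain ⟨Λ, hΛ0, hΛ, hΛb⟩ := exists_lipschitz_fderiv hb2 b.hasCompactSupport
  obtain ⟨δ, hδ0, hδ1, hδρ, hδ2⟩ : ∃ δ : ℝ, 0 < δ ∧ δ * Λ < 1 ∧ δ * Λ ≤ ρ ∧ δ ≤ (ρ / 2) ^ 2 / 20 := by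
    refine ⟨min (min 1 ρ / (Λ + 1)) ((ρ / 2) ^ 2 / 20), by positivity, ?_, ?_, min_le_right _ _⟩
    all_goals
      have h1 : min (min 1 ρ / (Λ + 1)) ((ρ / 2) ^ 2 / 20) * (Λ + 1) ≤ min 1 ρ := by
        rw [← le_div_iff₀ (by positivity)]
        exact min_le_left _ _
      have h2 : 0 < min (min 1 ρ / (Λ + 1)) ((ρ / 2) ^ 2 / 20) := by positivity
      have h3 := min_le_left 1 ρ
      have h4 := min_le_right 1 ρ
      linarith
  have hfd : ∀ z, fderiv ℝ (fun z => δ * b z) z = δ • fderiv ℝ b z := fun z =>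
    fderiv_const_mul (hb2.differentiable (by norm_num) z) δ
  refine ⟨fun z => δ * b z, δ, δ * Λ, hδ0, by positivity, hδ1, contDiff_const.mul hb2, ?_,
    fun z => mul_le_of_le_one_right hδ0.le b.le_one, fun v => ?_, fun z => ?_, fun x y => ?_⟩
  · exact (tsupport_mul_subset_right (f := fun _ => δ)).trans b.tsupport_eq.subset
  · rcases le_or_gt ‖v‖ (ρ / 2) with hv | hv
    · have : b (p + v) = 1 := b.one_of_mem_closedBall (by simpa using hv)
      simp only [this]
      linarith [sq_nonneg ‖v‖]
    · have h1 : (ρ / 2) ^ 2 ≤ ‖v‖ ^ 2 := pow_le_pow_left₀ (by positivity) hv.le 2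
      have h2 : 0 ≤ δ * b (p + v) := mul_nonneg hδ0.le b.nonneg
      simp only
      linarith
  · rw [hfd, norm_smul, Real.norm_of_nonneg hδ0.le]
    exact (mul_le_mul_of_nonneg_left (hΛb z) hδ0.le).trans hδρ
  · rw [hfd, hfd, ← smul_sub, norm_smul, Real.norm_of_nonneg hδ0.le, mul_assoc]
    exact mul_le_mul_of_nonneg_left (hΛ x y) hδ0.le

/-- An energy-capacity inequality: if the time-one map of `K` moves a ball a definite distance off
itself, then the Hofer norm of `K` is bounded below. -/
theorem exists_mem_closedBall_norm_sub_lt {S : E n → ℝ} {p : E n} {ρ m κ : ℝ}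
    (hS2 : ContDiff ℝ 2 S) (hSsupp : tsupport S ⊆ Metric.closedBall p ρ) (hρ : 0 ≤ ρ)
    (hSm : ∀ z, S z ≤ m) (hSlow : ∀ v, m - ‖v‖ ^ 2 / 20 ≤ S (p + v))
    (hSρ : ∀ z, ‖fderiv ℝ S z‖ ≤ ρ) (hκ0 : 0 ≤ κ) (hκ : κ < 1)
    (hSκ : ∀ a b, ‖fderiv ℝ S a - fderiv ℝ S b‖ ≤ κ * ‖a - b‖) (hm : 0 < m)
    {A : Set (E n)} {φ : E n → E n} {K : ℝ → E n → ℝ} (hK : AdmissibleHamiltonian A φ K)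
    (hKm : ∫ t in (0 : ℝ)..1, ⨆ x, |K t x| < m / 8) {η : ℝ} (hη : 0 < η) :
    ∃ x ∈ Metric.closedBall p (2 * ρ), ∃ y ∈ Metric.closedBall p (2 * ρ), ‖y - φ x‖ < η := by
  obtain ⟨hK2, ⟨C, hC, -, hKC⟩, ψ, hψ0, hψ, hψ1⟩ := hK
  obtain ⟨Λ, hB⟩ := exists_hamiltonianBounds hK2 hC hKC
  have hΛ0 := hB.nonneg
  have hslice := contDiff_slice hK2
  have hcs : ∀ t, HasCompactSupport (K t) := fun t => HasCompactSupport.intro hC (hKC t)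
  have hb : ∀ t, BddAbove (range fun x => |K t x|) := fun t =>
    (hslice t).continuous.abs.bddAbove_range_of_hasCompactSupport (hcs t).abs
  obtain ⟨M, hM⟩ := exists_nat_gt
    (Real.exp Λ * (Λ * (1 + 2 * Λ)) / η + Λ / 2 + Λ / (m / 8))
  have q1 : 0 ≤ Real.exp Λ * (Λ * (1 + 2 * Λ)) / η := by positivity
  have q2 : 0 ≤ Λ / 2 := by positivity
  have q3 : 0 ≤ Λ / (m / 8) := by positivity
  have hM0 : (0 : ℝ) < M := by linarith
  have hMpos : 0 < M := Nat.cast_pos.1 hM0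
  have hM1 : Real.exp Λ * (Λ * (1 + 2 * Λ)) / M < η := by
    rw [div_lt_comm₀ hM0 hη]
    linarith
  have hM2 : Λ / M < 2 := by
    rw [div_lt_comm₀ hM0 two_pos]
    linarith
  have hM3 : Λ / M < m / 8 := by
    rw [div_lt_comm₀ hM0 (by positivity)]
    linarith
  set τ : ℕ → ℝ := fun j => min (j / M) 1 with hτ
  have hτI : ∀ j, τ j ∈ Icc (0 : ℝ) 1 := fun j => ⟨le_min (by positivity) zero_le_one, min_le_right _ _⟩
  have hτj : ∀ j < M, τ j = j / M := fun j hj =>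
    min_eq_left ((div_le_one hM0).2 (by exact_mod_cast hj.le))
  have hfd : ∀ j z, fderiv ℝ (fun z => 1 / M * K (τ j) z) z = (1 / M : ℝ) • fderiv ℝ (K (τ j)) z :=
    fun j z => fderiv_const_mul ((hslice (τ j)).differentiable (by norm_num) z) _
  obtain ⟨u, hu0, hu, huM⟩ := exists_midStep_path_mem_closedBall hMpos hS2 hSsupp hρ hSm hSlow hSρ
    hκ0 hκ hSκ (k := fun j z => 1 / M * K (τ j) z) (Λ := Λ / M)
    (c := fun j => 1 / M * ⨆ x, |K (τ j) x|)
    (fun j => contDiff_const.mul (hslice (τ j))) (fun j => (hcs (τ j)).mul_left) hM2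
    (fun j a b => by
      rw [hfd, hfd, ← smul_sub, norm_smul, Real.norm_of_nonneg (by positivity)]
      have h1 := hB.norm_fderiv_sub_le (τ j) (hτI j) (τ j) (hτI j) a b
      rw [sub_self, abs_zero, zero_add] at h1
      calc _ ≤ 1 / M * (Λ * ‖a - b‖) := mul_le_mul_of_nonneg_left h1 (by positivity)
        _ = _ := by ring)
    (fun j z => by
      rw [abs_mul, abs_of_nonneg (by positivity : (0 : ℝ) ≤ 1 / M)]
      exact mul_le_mul_of_nonneg_left (le_ciSup (hb (τ j)) z) (by positivity))
    (by
      have h1 := sum_iSup_abs_le hB hb hMpos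
      have h2 : ∑ j ∈ Finset.range M, 1 / (M : ℝ) * ⨆ x, |K (τ j) x| =
          ∑ j ∈ Finset.range M, 1 / (M : ℝ) * ⨆ x, |K (j / M) x| :=
        Finset.sum_congr rfl fun j hj => by rw [hτj j (Finset.mem_range.1 hj)]
      rw [h2]
      linarith)
  refine ⟨u 0, hu0, u M, huM, ?_⟩
  have h := norm_midStep_path_sub_flow_le hB
    (fun t => (hslice t).differentiable (by norm_num)) (γ := fun s => ψ s (u 0)) (hψ (u 0)) hMpos
    (u := u) (by simp [hψ0]) (fun j hj => by
      have h1 := hu j hj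
      rwa [hτj j hj] at h1)
  rw [hψ1] at h
  exact h.trans_lt hM1

end MainTheorem

/-- Non-degeneracy of the Hofer distance: a compactly supported `C²`
symplectomorphism of `ℝ^{2n}` at vanishing Hofer distance from the identity is the
identity. -/
theorem hofer_distance_nondegenerate
    (n : ℕ) (A : Set (E n)) (hAo : IsOpen A) (hAb : Bornology.IsBounded A)
    (φ : E n → E n) (hφ : ContDiff ℝ 2 φ)
    (hφinv : ∃ ψ : E n → E n, ContDiff ℝ 2 ψ ∧
      Function.LeftInverse ψ φ ∧ Function.RightInverse ψ φ)
    (hSp : ∀ (x y z : E n), symp (fderiv ℝ φ x y) (fderiv ℝ φ x z) = symp y z)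
    (hφid : ∃ C : Set (E n), IsCompact C ∧ C ⊆ A ∧ ∀ x ∉ C, φ x = x)
    (hsmall : ∀ ε : ℝ, 0 < ε → ∃ K : ℝ → E n → ℝ,
      AdmissibleHamiltonian A φ K ∧
      (∫ t in (0:ℝ)..1, ⨆ x : E n, |K t x|) < ε) :
    ∀ x : E n, φ x = x := by
  intro p
  by_contra hp
  have hd : 0 < ‖φ p - p‖ := norm_pos_iff.2 (sub_ne_zero.2 hp)
  set d := ‖φ p - p‖
  obtain ⟨r, hr0, hr⟩ := Metric.continuousAt_iff.1 hφ.continuous.continuousAt (d / 3)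
    (by positivity : 0 < d / 3)
  obtain ⟨ρ, hρ0, hρr, hρd⟩ : ∃ ρ : ℝ, 0 < ρ ∧ 2 * ρ < r ∧ 2 * ρ ≤ d / 3 := by
    refine ⟨min (r / 4) (d / 6), by positivity, ?_, ?_⟩
    · linarith [min_le_left (r / 4) (d / 6)]
    · linarith [min_le_right (r / 4) (d / 6)]
  obtain ⟨S, m, κ, hm, hκ0, hκ, hS2, hSsupp, hSm, hSlow, hSρ, hSκ⟩ := exists_small_bump p hρ0
  obtain ⟨K, hK, hKm⟩ := hsmall (m / 8) (by positivity)
  obtain ⟨x, hx, y, hy, hxy⟩ := exists_mem_closedBall_norm_sub_lt hS2 hSsupp hρ0.le hSm hSlow hSρ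
    hκ0 hκ hSκ hm hK hKm (η := d / 3) (by positivity)
  have h1 : dist (φ x) (φ p) < d / 3 := hr (hx.trans_lt hρr)
  have h2 : dist y p ≤ d / 3 := hy.trans hρd
  rw [dist_eq_norm] at h1 h2
  have h3 : φ p - p = -(φ x - φ p) - (y - φ x) + (y - p) := by abel
  have h4 : d ≤ ‖φ x - φ p‖ + ‖y - φ x‖ + ‖y - p‖ := by
    calc d = ‖-(φ x - φ p) - (y - φ x) + (y - p)‖ := by rw [← h3]
      _ ≤ _ := (norm_add_le _ _).trans (add_le_add
        ((norm_sub_le _ _).trans_eq (by rw [norm_neg])) le_rfl)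
  linarith
end
end

section
/- (Ball-Box theorem for H(n).) There exist constants 0 < c < C such that for every ε > 0: { (x, x̄) ∈ ℝ^{2n} × ℝ : |x| ≤ cε and |x̄| ≤ cε² } ⊆ { p ∈ H(n) : d_CC(0, p) ≤ ε } ⊆ { (x, x̄) ∈ ℝ^{2n} × ℝ : |x| ≤ Cε and |x̄| ≤ Cε² }, where |x| is the Euclidean norm on ℝ^{2n} and |x̄| the absolute value on ℝ. -/
open MeasureTheory Set Function
open scoped BigOperators Topology NNReal

noncomputable section

/-- The Heisenberg group `H(n) = ℝ^{2n} × ℝ` as a set. -/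
abbrev Heis (n : ℕ) := E n × ℝ

/-- The a.e. horizontality condition on `[0,1]` for a curve `(c, cb)` in `H(n)`. -/
def HorizOn {n : ℕ} (c : ℝ → E n) (cb : ℝ → ℝ) : Prop :=
  ∀ᵐ t ∂(volume.restrict (Icc (0:ℝ) 1)),
    HasDerivAt cb ((1/2) * symp (c t) (deriv c t)) t

/-- The Carnot–Carathéodory distance on `H(n)`. -/
def ccDist {n : ℕ} (p q : Heis n) : ℝ :=
  sInf { L : ℝ | ∃ (c : ℝ → E n) (cb : ℝ → ℝ) (K K' : ℝ≥0),
    LipschitzWith K c ∧ LipschitzWith K' cb ∧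
    c 0 = p.1 ∧ cb 0 = p.2 ∧ c 1 = q.1 ∧ cb 1 = q.2 ∧
    HorizOn c cb ∧
    L = ∫ t in Icc (0:ℝ) 1, ‖deriv c t‖ }

/-- A real Lipschitz function is controlled by any integrable bound on its derivative. -/
theorem LipschitzWith.abs_sub_le_integral {f h : ℝ → ℝ} {K : ℝ≥0} (hf : LipschitzWith K f)
    {a b : ℝ} (hab : a ≤ b) (hint : IntervalIntegrable h volume a b)
    (hle : ∀ᵐ t ∂(volume.restrict (Ioc a b)), |deriv f t| ≤ h t) :
    |f b - f a| ≤ ∫ t in a..b, h t := by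
  rw [← (hf.lipschitzOnWith (s := uIcc a b)).absolutelyContinuousOnInterval.integral_deriv_eq_sub]
  rw [← Real.norm_eq_abs]
  refine intervalIntegral.norm_integral_le_of_norm_le hab ?_ hint
  exact (ae_restrict_iff' measurableSet_Ioc).1 hle

theorem LipschitzWith.intervalIntegrable_norm_deriv {V : Type*} [NormedAddCommGroup V]
    [NormedSpace ℝ V] [CompleteSpace V] {f : ℝ → V} {K : ℝ≥0} (hf : LipschitzWith K f) (a b : ℝ) :
    IntervalIntegrable (fun t => ‖deriv f t‖) volume a b := by
  refine (intervalIntegrable_const (c := (K : ℝ))).mono_fun ?_ ?_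
  · exact (stronglyMeasurable_deriv f).norm.aestronglyMeasurable
  · refine Filter.Eventually.of_forall fun t => ?_
    simpa using norm_deriv_le_of_lipschitz hf

/-- The displacement of a Lipschitz curve is at most its length. -/
theorem LipschitzWith.norm_sub_le_integral {V : Type*} [NormedAddCommGroup V]
    [InnerProductSpace ℝ V] [FiniteDimensional ℝ V] {f : ℝ → V} {K : ℝ≥0}
    (hf : LipschitzWith K f) {a b : ℝ} (hab : a ≤ b) :
    ‖f b - f a‖ ≤ ∫ t in a..b, ‖deriv f t‖ := by
  set w := f b - f a with hw
  by_cases hw0 : w = 0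
  · rw [hw0, norm_zero]
    exact intervalIntegral.integral_nonneg hab fun t _ => norm_nonneg _
  have hlip := (innerSL ℝ w).lipschitz.comp hf
  have key := hlip.abs_sub_le_integral hab
    ((hf.intervalIntegrable_norm_deriv a b).const_mul ‖w‖) (by
      refine ae_restrict_of_ae ?_
      filter_upwards [hf.ae_differentiableAt_real] with t ht
      have hd : HasDerivAt ((innerSL ℝ w) ∘ f) (innerSL ℝ w (deriv f t)) t :=
        (innerSL ℝ w).hasFDerivAt.comp_hasDerivAt t ht.hasDerivAt
      rw [hd.deriv]
      exact abs_real_inner_le_norm w (deriv f t))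
  rw [intervalIntegral.integral_const_mul] at key
  have h2 : ((innerSL ℝ w) ∘ f) b - ((innerSL ℝ w) ∘ f) a = ‖w‖ * ‖w‖ := by
    simp only [comp_apply, ← map_sub, ← hw]
    exact real_inner_self_eq_norm_mul_norm w
  rw [h2, abs_of_nonneg (by positivity)] at key
  exact le_of_mul_le_mul_left key (norm_pos_iff.2 hw0)

theorem abs_symp_le {n : ℕ} (x y : E n) : |symp x y| ≤ 2 * n * (‖x‖ * ‖y‖) := by
  have h : ∀ i : Fin n, |x (Sum.inl i) * y (Sum.inr i) - x (Sum.inr i) * y (Sum.inl i)|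
      ≤ 2 * (‖x‖ * ‖y‖) := by
    intro i
    have hmul : ∀ j k, |x j * y k| ≤ ‖x‖ * ‖y‖ := fun j k => by
      rw [abs_mul]
      exact mul_le_mul (PiLp.norm_apply_le x j) (PiLp.norm_apply_le y k) (abs_nonneg _)
        (norm_nonneg _)
    have h1 := abs_sub (x (Sum.inl i) * y (Sum.inr i)) (x (Sum.inr i) * y (Sum.inl i))
    linarith [hmul (Sum.inl i) (Sum.inr i), hmul (Sum.inr i) (Sum.inl i)]
  calc |symp x y| ≤ _ := Finset.abs_sum_le_sum_abs _ _
    _ ≤ ∑ _i : Fin n, 2 * (‖x‖ * ‖y‖) := Finset.sum_le_sum fun i _ => h i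
    _ = _ := by simp; ring

/-- Endpoint bounds for a horizontal curve issuing from the origin, in terms of its length. -/
theorem HorizOn.endpoint_bounds {n : ℕ} {c : ℝ → E n} {cb : ℝ → ℝ} {K K' : ℝ≥0}
    (hc : LipschitzWith K c) (hcb : LipschitzWith K' cb) (hc0 : c 0 = 0) (hcb0 : cb 0 = 0)
    (h : HorizOn c cb) :
    ‖c 1‖ ≤ ∫ t in Icc (0:ℝ) 1, ‖deriv c t‖ ∧
      |cb 1| ≤ n * (∫ t in Icc (0:ℝ) 1, ‖deriv c t‖) ^ 2 := by
  have hI : ∫ t in Icc (0:ℝ) 1, ‖deriv c t‖ = ∫ t in (0:ℝ)..1, ‖deriv c t‖ := by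
    rw [integral_Icc_eq_integral_Ioc, intervalIntegral.integral_of_le zero_le_one]
  rw [hI]
  set L := ∫ t in (0:ℝ)..1, ‖deriv c t‖ with hL
  have hbound : ∀ t ∈ Icc (0:ℝ) 1, ‖c t‖ ≤ L := by
    intro t ht
    have h1 := hc.norm_sub_le_integral ht.1
    rw [hc0, sub_zero] at h1
    refine h1.trans ?_
    exact intervalIntegral.integral_mono_interval le_rfl ht.1 ht.2
      (Filter.Eventually.of_forall fun s => norm_nonneg _) (hc.intervalIntegrable_norm_deriv 0 1)
  refine ⟨hbound 1 (by simp), ?_⟩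
  have key := hcb.abs_sub_le_integral zero_le_one
    ((hc.intervalIntegrable_norm_deriv 0 1).const_mul (n * L)) (by
      have h' := ae_restrict_of_ae_restrict_of_subset (Ioc_subset_Icc_self (a := (0:ℝ)) (b := 1)) h
      filter_upwards [h', ae_restrict_mem measurableSet_Ioc] with t ht hmem
      rw [ht.deriv, abs_mul, abs_of_pos (by norm_num : (0:ℝ) < 1 / 2)]
      have h1 := abs_symp_le (c t) (deriv c t)
      have h2 : n * (‖c t‖ * ‖deriv c t‖) ≤ n * (L * ‖deriv c t‖) := by
        gcongr
        exact hbound t (Ioc_subset_Icc_self hmem)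
      linarith)
  rw [intervalIntegral.integral_const_mul, hcb0, sub_zero, ← hL] at key
  linarith

theorem symp_curve {n : ℕ} (x u v : E n) (t a b a' b' : ℝ) :
    symp (t • x + a • u + b • v) (x + a' • u + b' • v) =
      symp x u * (t * a' - a) + symp x v * (t * b' - b) + symp u v * (a * b' - b * a') := by
  simp only [symp, Finset.sum_mul, ← Finset.sum_add_distrib]
  refine Finset.sum_congr rfl fun i _ => ?_
  simp only [PiLp.add_apply, PiLp.smul_apply, smul_eq_mul]
  ring

theorem symp_single {n : ℕ} (i : Fin n) (a b : ℝ) :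
    symp (EuclideanSpace.single (Sum.inl i) a : E n) (EuclideanSpace.single (Sum.inr i) b)
      = a * b := by
  simp [symp]

/-- A `C¹` curve stopped outside `[0,1]` is globally Lipschitz. -/
theorem ContDiff.exists_lipschitzWith_projIcc {V : Type*} [NormedAddCommGroup V]
    [NormedSpace ℝ V] {f : ℝ → V} (hf : ContDiff ℝ 1 f) :
    ∃ K : ℝ≥0, LipschitzWith K fun t : ℝ => f (projIcc (0:ℝ) 1 zero_le_one t) := by
  obtain ⟨K, hK⟩ := (hf.locallyLipschitz.locallyLipschitzOn
    (s := Icc (0:ℝ) 1)).exists_lipschitzOnWith_of_compact isCompact_Icc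
  exact ⟨K * 1, (lipschitzOnWith_iff_restrict.1 hK).comp (LipschitzWith.projIcc zero_le_one)⟩

theorem HasDerivAt.comp_projIcc {V : Type*} [NormedAddCommGroup V] [NormedSpace ℝ V]
    {f : ℝ → V} {f' : V} {t : ℝ} (hf : HasDerivAt f f' t) (ht : t ∈ Ioo (0:ℝ) 1) :
    HasDerivAt (fun s => f (projIcc 0 1 zero_le_one s)) f' t := by
  refine hf.congr_of_eventuallyEq ?_
  filter_upwards [Ioo_mem_nhds ht.1 ht.2] with s hs
  rw [projIcc_of_mem zero_le_one (Ioo_subset_Icc_self hs)]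

/-- A smooth horizontal path on `[0,1]` produces an upper bound for the distance. -/
theorem exists_horizontal_of_contDiff {n : ℕ} {c c' : ℝ → E n} {cb : ℝ → ℝ} {M : ℝ}
    (hc : ContDiff ℝ 1 c) (hcb : ContDiff ℝ 1 cb) (hc' : ∀ t, HasDerivAt c (c' t) t)
    (hcb' : ∀ t, HasDerivAt cb ((1/2) * symp (c t) (c' t)) t)
    (hM : ∀ t ∈ Icc (0:ℝ) 1, ‖c' t‖ ≤ M) :
    ∃ (d : ℝ → E n) (db : ℝ → ℝ) (K K' : ℝ≥0),
      LipschitzWith K d ∧ LipschitzWith K' db ∧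
      d 0 = c 0 ∧ db 0 = cb 0 ∧ d 1 = c 1 ∧ db 1 = cb 1 ∧
      HorizOn d db ∧ ∫ t in Icc (0:ℝ) 1, ‖deriv d t‖ ≤ M := by
  obtain ⟨K, hK⟩ := hc.exists_lipschitzWith_projIcc
  obtain ⟨K', hK'⟩ := hcb.exists_lipschitzWith_projIcc
  refine ⟨_, _, K, K', hK, hK', by simp, by simp, by simp, by simp, ?_, ?_⟩
  · rw [HorizOn, Measure.restrict_congr_set Ioo_ae_eq_Icc.symm]
    filter_upwards [ae_restrict_mem measurableSet_Ioo] with t ht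
    rw [((hc' t).comp_projIcc ht).deriv]
    have h := (hcb' t).comp_projIcc ht
    simpa only [projIcc_of_mem zero_le_one (Ioo_subset_Icc_self ht)] using h
  · rw [integral_Icc_eq_integral_Ioo]
    have h := norm_setIntegral_le_of_norm_le_const (μ := volume) (s := Ioo (0:ℝ) 1) (C := M)
      (f := fun t => ‖deriv (fun s => c (projIcc 0 1 zero_le_one s)) t‖) (by simp) (by
        intro t ht
        rw [((hc' t).comp_projIcc ht).deriv, norm_norm]
        exact hM t (Ioo_subset_Icc_self ht))
    simpa using (le_abs_self _).trans h

/-- Every point is reached from the origin by a horizontal curve of controlled length. -/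
theorem exists_horizontal_to {n : ℕ} (hn : 1 ≤ n) (x : E n) (s : ℝ) :
    ∃ (d : ℝ → E n) (db : ℝ → ℝ) (K K' : ℝ≥0),
      LipschitzWith K d ∧ LipschitzWith K' db ∧
      d 0 = 0 ∧ db 0 = 0 ∧ d 1 = x ∧ db 1 = s ∧
      HorizOn d db ∧ ∫ t in Icc (0:ℝ) 1, ‖deriv d t‖ ≤ ‖x‖ + 76 * √(70 * |s|) := by
  set r := √(70 * |s|) with hr
  have hr2 : r * r = 70 * |s| := Real.mul_self_sqrt (by positivity)
  obtain ⟨b, hb, hab⟩ : ∃ b : ℝ, |b| = r ∧ r * b = -70 * s := by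
    rcases le_total 0 s with hs | hs
    · refine ⟨-r, by rw [abs_neg, abs_of_nonneg (Real.sqrt_nonneg _)], ?_⟩
      rw [abs_of_nonneg hs] at hr2
      linarith
    · refine ⟨r, abs_of_nonneg (Real.sqrt_nonneg _), ?_⟩
      rw [abs_of_nonpos hs] at hr2
      linarith
  let i : Fin n := ⟨0, hn⟩
  set u : E n := EuclideanSpace.single (Sum.inl i) r with hu
  set v : E n := EuclideanSpace.single (Sum.inr i) b with hv
  have huv : symp u v = -70 * s := by rw [hu, hv, symp_single, hab]
  have hun : ‖u‖ = r := by
    rw [hu, PiLp.norm_single, Real.norm_of_nonneg (Real.sqrt_nonneg _)]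
  have hvn : ‖v‖ = r := by rw [hv, PiLp.norm_single, Real.norm_eq_abs, hb]
  let c : ℝ → E n := fun t => t • x + (t - 3 * t ^ 2 + 2 * t ^ 3) • u
    + (t - 6 * t ^ 2 + 10 * t ^ 3 - 5 * t ^ 4) • v
  let c' : ℝ → E n := fun t => x + (1 - 6 * t + 6 * t ^ 2) • u
    + (1 - 12 * t + 30 * t ^ 2 - 20 * t ^ 3) • v
  let cb : ℝ → ℝ := fun t => (1 / 2) * (symp x u * (-t ^ 3 + t ^ 4)
    + symp x v * (-2 * t ^ 3 + 5 * t ^ 4 - 3 * t ^ 5)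
    + symp u v * (-t ^ 3 + 4 * t ^ 4 - 33 / 5 * t ^ 5 + 5 * t ^ 6 - 10 / 7 * t ^ 7))
  obtain ⟨d, db, K, K', hK, hK', h0, hb0, h1, hb1, hH, hL⟩ :=
    exists_horizontal_of_contDiff (c := c) (c' := c') (cb := cb) (M := ‖x‖ + 76 * r)
      (by fun_prop) (by fun_prop)
      (by
        intro t
        have hp (k : ℕ) := hasDerivAt_pow k t
        have hφ : HasDerivAt (fun t : ℝ => t - 3 * t ^ 2 + 2 * t ^ 3) (1 - 6 * t + 6 * t ^ 2) t := by
          refine HasDerivAt.congr_deriv (((hasDerivAt_id t).sub ((hp 2).const_mul 3)).add ((hp 3).const_mul 2)) ?_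
          norm_num
          ring
        have hψ : HasDerivAt (fun t : ℝ => t - 6 * t ^ 2 + 10 * t ^ 3 - 5 * t ^ 4)
            (1 - 12 * t + 30 * t ^ 2 - 20 * t ^ 3) t := by
          refine HasDerivAt.congr_deriv ((((hasDerivAt_id t).sub ((hp 2).const_mul 6)).add
            ((hp 3).const_mul 10)).sub ((hp 4).const_mul 5)) ?_
          norm_num
          ring
        have hx := (hasDerivAt_id t).smul_const x
        rw [one_smul] at hx
        exact (hx.add (hφ.smul_const u)).add (hψ.smul_const v))
      (by
        intro t
        have hp (k : ℕ) := hasDerivAt_pow k t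
        rw [symp_curve]
        refine HasDerivAt.const_mul (1 / 2) ?_
        refine ((HasDerivAt.const_mul (symp x u) ?_).add (HasDerivAt.const_mul (symp x v) ?_)).add
          (HasDerivAt.const_mul (symp u v) ?_)
        · refine HasDerivAt.congr_deriv ((hp 3).neg.add (hp 4)) ?_
          norm_num
          ring
        · refine HasDerivAt.congr_deriv ((((hp 3).const_mul (-2)).add ((hp 4).const_mul 5)).sub
            ((hp 5).const_mul 3)) ?_
          norm_num
          ring
        · refine HasDerivAt.congr_deriv (((((hp 3).neg.add ((hp 4).const_mul 4)).sub ((hp 5).const_mul (33 / 5))).add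
            ((hp 6).const_mul 5)).sub ((hp 7).const_mul (10 / 7))) ?_
          norm_num
          ring)
      (by
        intro t ht
        have h2 : t ^ 2 ≤ 1 := pow_le_one₀ ht.1 ht.2
        have h3 : t ^ 3 ≤ 1 := pow_le_one₀ ht.1 ht.2
        have h2' : 0 ≤ t ^ 2 := pow_nonneg ht.1 _
        have h3' : 0 ≤ t ^ 3 := pow_nonneg ht.1 _
        have hφ : |1 - 6 * t + 6 * t ^ 2| ≤ 13 := by
          rw [abs_le]
          constructor <;> linarith [ht.1, ht.2]
        have hψ : |1 - 12 * t + 30 * t ^ 2 - 20 * t ^ 3| ≤ 63 := by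
          rw [abs_le]
          constructor <;> linarith [ht.1, ht.2]
        have hrn : 0 ≤ r := Real.sqrt_nonneg _
        calc ‖c' t‖ ≤ ‖x‖ + |1 - 6 * t + 6 * t ^ 2| * ‖u‖
              + |1 - 12 * t + 30 * t ^ 2 - 20 * t ^ 3| * ‖v‖ := by
              refine norm_add₃_le.trans ?_
              rw [norm_smul, norm_smul, Real.norm_eq_abs, Real.norm_eq_abs]
          _ ≤ ‖x‖ + 13 * r + 63 * r := by rw [hun, hvn]; gcongr
          _ = ‖x‖ + 76 * r := by ring)
  refine ⟨d, db, K, K', hK, hK', ?_, ?_, ?_, ?_, hH, hL⟩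
  · simp [h0, c]
  · simp [hb0, cb]
  · rw [h1]
    norm_num [c]
  · rw [hb1]
    simp only [cb, huv]
    ring

/-- The Ball-Box theorem for the Heisenberg group: the Carnot–Carathéodory ball of
radius `ε` is squeezed between the boxes `|x| ≤ cε, |x̄| ≤ cε²` and
`|x| ≤ Cε, |x̄| ≤ Cε²`. -/
theorem ball_box_theorem (n : ℕ) (hn : 1 ≤ n) :
    ∃ c C : ℝ, 0 < c ∧ c < C ∧
      ∀ ε : ℝ, 0 < ε →
        {p : Heis n | ‖p.1‖ ≤ c * ε ∧ |p.2| ≤ c * ε^2}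
            ⊆ {p : Heis n | ccDist 0 p ≤ ε} ∧
        {p : Heis n | ccDist 0 p ≤ ε}
            ⊆ {p : Heis n | ‖p.1‖ ≤ C * ε ∧ |p.2| ≤ C * ε^2} := by
  refine ⟨1 / 1000000, 4 * n + 2, by norm_num, by linarith [Nat.cast_nonneg (α := ℝ) n], ?_⟩
  intro ε hε
  constructor
  · rintro ⟨x, s⟩ ⟨hx, hs⟩
    obtain ⟨d, db, K, K', hK, hK', h0, hb0, h1, hb1, hH, hL⟩ := exists_horizontal_to hn x s
    have hle : ccDist 0 (x, s) ≤ ∫ t in Icc (0:ℝ) 1, ‖deriv d t‖ := by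
      refine csInf_le ⟨0, ?_⟩ ⟨d, db, K, K', hK, hK', h0, hb0, h1, hb1, hH, rfl⟩
      rintro L ⟨_, _, _, _, -, -, -, -, -, -, -, rfl⟩
      exact integral_nonneg fun _ => norm_nonneg _
    have hsqrt : √(70 * |s|) ≤ ε / 100 := by
      refine Real.sqrt_le_iff.2 ⟨by positivity, ?_⟩
      dsimp only at hs
      nlinarith [sq_nonneg ε]
    dsimp only at hx
    change ccDist 0 (x, s) ≤ ε
    linarith
  · rintro ⟨x, s⟩ hp
    have hlt : ccDist 0 (x, s) < 2 * ε := lt_of_le_of_lt hp (by linarith)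
    unfold ccDist at hlt
    obtain ⟨d, db, K, K', hK, hK', h0, hb0, h1, hb1, hH, -⟩ := exists_horizontal_to hn x s
    obtain ⟨L, ⟨c, cb, K, K', hK, hK', h0, hb0, h1, hb1, hH, rfl⟩, hL⟩ :=
      exists_lt_of_csInf_lt
        (by exact ⟨_, d, db, K, K', hK, hK', h0, hb0, h1, hb1, hH, rfl⟩) hlt
    obtain ⟨hx, hs⟩ := hH.endpoint_bounds hK hK' h0 hb0
    rw [h1] at hx
    rw [hb1] at hs
    have hn0 : (0:ℝ) ≤ n := Nat.cast_nonneg n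
    have hI : 0 ≤ ∫ t in Icc (0:ℝ) 1, ‖deriv c t‖ := integral_nonneg fun _ => norm_nonneg _
    refine ⟨hx.trans (hL.le.trans ?_), hs.trans ?_⟩
    · nlinarith
    · calc (n:ℝ) * (∫ t in Icc (0:ℝ) 1, ‖deriv c t‖) ^ 2 ≤ n * (2 * ε) ^ 2 := by gcongr
        _ ≤ (4 * n + 2) * ε ^ 2 := by nlinarith [sq_nonneg ε]
end
end
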